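/- arXiv:2106.14869 — 8 statements merged into one kernel-verified Lean document; each statement's English description precedes it below -/
import Mathlib

section
/- Let h ≥ 1 and let G be a finite simple graph that has no K_{3,h} minor. Let χ be a 2-stable coloring of G, let D := {v ∈ V(G) : |[v]_χ| = 1}, and assume that |[w]_χ| ≥ 3 for every w ∈ V(G) \ D. Then for every connected component Z of G − D it holds that |N_G(Z)| < h. (This is Lemma 'small-separator' of the paper in the explicit-coloring form used in its proof.) -/
/-- A coloring of pairs of vertices is 2-stable for `G`: equally colored pairs agree on
equality, adjacency, and for all pairs of colors `(a,b)` on the number of common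
"extensions" `w`. -/
def IsTwoStable {V C : Type*} (G : SimpleGraph V) (χ : V → V → C) : Prop :=
  ∀ u v u' v' : V, χ u v = χ u' v' →
    (u = v ↔ u' = v') ∧ (G.Adj u v ↔ G.Adj u' v') ∧
    ∀ a b : C, {w : V | χ u w = a ∧ χ w v = b}.ncard =
      {w : V | χ u' w = a ∧ χ w v' = b}.ncard

/-- `G` has a `K_{3,h}` minor: three branch sets and `h` branch sets, all pairwise
disjoint, nonempty and connected, with an edge between each of the three and each of
the `h` sets. -/
def HasK3hMinor {V : Type*} (G : SimpleGraph V) (h : ℕ) : Prop :=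
  ∃ (B : Fin 3 → Set V) (D : Fin h → Set V),
    (∀ r, (B r).Nonempty) ∧ (∀ j, (D j).Nonempty) ∧
    (∀ r, (G.induce (B r)).Connected) ∧ (∀ j, (G.induce (D j)).Connected) ∧
    (∀ r r', r ≠ r' → Disjoint (B r) (B r')) ∧
    (∀ j j', j ≠ j' → Disjoint (D j) (D j')) ∧
    (∀ r j, Disjoint (B r) (D j)) ∧
    (∀ r j, ∃ b ∈ B r, ∃ d ∈ D j, G.Adj b d)

/-- `S` contains `r`, and every point of `S` is reached from `r` by `A`-steps inside `S`. -/
def RootedIn {X : Type*} (A : X → X → Prop) (S : Set X) (r : X) : Prop :=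
  r ∈ S ∧ ∀ x ∈ S, Relation.ReflTransGen (fun a b => A a b ∧ a ∈ S ∧ b ∈ S) r x

theorem reflTransGen_step_mono {X : Type*} {A : X → X → Prop} {S T : Set X} (hST : S ⊆ T)
    {x y : X} (h : Relation.ReflTransGen (fun a b => A a b ∧ a ∈ S ∧ b ∈ S) x y) :
    Relation.ReflTransGen (fun a b => A a b ∧ a ∈ T ∧ b ∈ T) x y :=
  Relation.ReflTransGen.mono (fun _ _ hab => ⟨hab.1, hST hab.2.1, hST hab.2.2⟩) _ _ h

/-- Gluing two rooted connected sets along an edge, together with extra points attached to the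
second one. -/
theorem RootedIn.union {X : Type*} {A : X → X → Prop} (hA : ∀ x y, A x y → A y x)
    {S S' T : Set X} {r p q : X} (hS : RootedIn A S r) (hS' : RootedIn A S' q)
    (hp : p ∈ S) (hpq : A p q) (hT : ∀ x ∈ T, ∃ y ∈ S', A x y) :
    RootedIn A (S ∪ S' ∪ T) r := by
  have h1 : S ⊆ S ∪ S' ∪ T := fun x hx => Or.inl (Or.inl hx)
  have h2 : S' ⊆ S ∪ S' ∪ T := fun x hx => Or.inl (Or.inr hx)
  have h3 : ∀ x ∈ S', Relation.ReflTransGen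
      (fun a b => A a b ∧ a ∈ S ∪ S' ∪ T ∧ b ∈ S ∪ S' ∪ T) r x := fun x hx =>
    ((reflTransGen_step_mono h1 (hS.2 p hp)).tail ⟨hpq, h1 hp, h2 hS'.1⟩).trans
      (reflTransGen_step_mono h2 (hS'.2 x hx))
  refine ⟨h1 hS.1, ?_⟩
  rintro x ((hx | hx) | hx)
  · exact reflTransGen_step_mono h1 (hS.2 x hx)
  · exact h3 x hx
  · obtain ⟨y, hy, hxy⟩ := hT x hx
    exact (h3 y hy).tail ⟨hA _ _ hxy, h2 hy, Or.inr hx⟩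

/-- A family `Inv` of relations on `X`, closed under first-order operations with three
variables, that cannot distinguish points in the same fiber of `κ`. -/
structure HomogeneousRels {X ι : Type*} (A : X → X → Prop) (κ : X → ι)
    (Inv : (X → X → Prop) → Prop) : Prop where
  eq : Inv (fun x y => x = y)
  adj : Inv A
  fiber : ∀ i, Inv (fun x _ => κ x = i)
  not : ∀ R, Inv R → Inv (fun x y => ¬ R x y)
  and : ∀ R S, Inv R → Inv S → Inv (fun x y => R x y ∧ S x y)
  comp : ∀ R S, Inv R → Inv S → Inv (fun x y => ∃ z, R x z ∧ S z y)
  swap : ∀ R, Inv R → Inv (fun x y => R y x)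
  diag : ∀ R, Inv R → ∀ x x', κ x = κ x' → R x x → R x' x'

namespace HomogeneousRels

variable {X ι : Type*} {A : X → X → Prop} {κ : X → ι} {Inv : (X → X → Prop) → Prop}

theorem exists_of_exists (hI : HomogeneousRels A κ Inv) {R : X → X → Prop} (hR : Inv R)
    {x x' y : X} (hx : κ x = κ x') (h : R x y) : ∃ y', R x' y' := by
  obtain ⟨y', h1, -⟩ := hI.diag _ (hI.comp _ _ hR (hI.swap _ hR)) x x' hx ⟨y, h, h⟩
  exact ⟨y', h1⟩

theorem adj_fiber (hI : HomogeneousRels A κ Inv) (j : ι) :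
    Inv (fun x y => A x y ∧ κ y = j) :=
  hI.and _ _ hI.adj (hI.swap _ (hI.fiber j))

theorem forall_iff (hI : HomogeneousRels A κ Inv) {M : X → X → Prop} (hM : Inv M) :
    Inv (fun x y => ∀ z, M x z ↔ M y z) := by
  have h1 := hI.not _ (hI.comp _ _ hM (hI.swap _ (hI.not _ hM)))
  have h2 := hI.and _ _ h1 (hI.swap _ h1)
  convert h2 using 3 with x y
  constructor
  · intro h
    exact ⟨fun ⟨z, hz, hz'⟩ => hz' ((h z).1 hz), fun ⟨z, hz, hz'⟩ => hz' ((h z).2 hz)⟩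
  · rintro ⟨h, h'⟩ z
    exact ⟨fun hz => by_contra fun hn => h ⟨z, hz, hn⟩,
      fun hz => by_contra fun hn => h' ⟨z, hz, hn⟩⟩

end HomogeneousRels

/-- Hall's theorem for three sets with at least two elements each. -/
theorem exists_injective_of_three {X : Type*} [Finite X] (N : Fin 3 → Set X)
    (h2 : ∀ i, ∃ a ∈ N i, ∃ b ∈ N i, a ≠ b)
    (h3 : (¬ ∀ i j, N i = N j) ∨ ∃ f : Fin 3 → X, Function.Injective f ∧ ∀ k i, f k ∈ N i) :
    ∃ w : Fin 3 → X, Function.Injective w ∧ ∀ i, w i ∈ N i := by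
  classical
  rcases h3 with h3 | ⟨f, hf, hfN⟩
  swap
  · exact ⟨f, hf, fun i => hfN i i⟩
  have := Fintype.ofFinite X
  have key := (Finset.all_card_le_biUnion_card_iff_exists_injective
    (fun i => (N i).toFinset)).1 ?_
  · obtain ⟨w, hw, hw'⟩ := key
    exact ⟨w, hw, fun i => by simpa using hw' i⟩
  intro s
  have hc : ∀ i, 2 ≤ ((N i).toFinset).card := fun i => by
    obtain ⟨a, ha, b, hb, hab⟩ := h2 i
    exact Finset.one_lt_card.2 ⟨a, by simpa using ha, b, by simpa using hb, hab⟩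
  by_contra hlt
  push Not at hlt
  have hs3 : s.card ≤ 3 := by simpa using Finset.card_le_univ s
  obtain ⟨i, hi⟩ : s.Nonempty := by
    rw [Finset.nonempty_iff_ne_empty]; rintro rfl; simp at hlt
  have hge : ∀ i ∈ s, (N i).toFinset ⊆ s.biUnion (fun i => (N i).toFinset) := fun i hi =>
    Finset.subset_biUnion_of_mem (fun i => (N i).toFinset) hi
  have h2' := (hc i).trans (Finset.card_le_card (hge i hi))
  have hs : s = Finset.univ := by
    rw [← Finset.card_eq_iff_eq_univ]; simp; omega
  subst hs
  have hU : ∀ i, (N i).toFinset = Finset.univ.biUnion (fun i => (N i).toFinset) := fun i =>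
    Finset.eq_of_subset_of_card_le (hge i (Finset.mem_univ i)) (by have := hc i; omega)
  apply h3
  intro i j
  have := (hU i).trans (hU j).symm
  simpa using this

/-- Triples of points in the fiber over `d`, not all `E`-equivalent, extend to disjoint connected
sets meeting all fibers over `U` and covering the `E`-classes of the given points. -/
structure GoodRel {X ι : Type*} (A : X → X → Prop) (κ : X → ι) (Inv : (X → X → Prop) → Prop)
    (U : Set ι) (d : ι) (E : X → X → Prop) : Prop where
  inv : Inv E
  equiv : Equivalence E
  nontotal : ∃ x y, κ x = d ∧ κ y = d ∧ ¬ E x y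
  ext : ∀ v : Fin 3 → X, Function.Injective v → (∀ i, κ (v i) = d) →
    (¬ ∀ i j, E (v i) (v j)) → ∃ H : Fin 3 → Set X,
      (∀ i, RootedIn A (H i) (v i)) ∧ (∀ i j x, x ∈ H i → x ∈ H j → i = j) ∧
      (∀ i x, x ∈ H i → κ x ∈ U) ∧ (∀ i x, κ x ∈ U → ∃ y ∈ H i, κ y = κ x) ∧
      (∀ x i, κ x = d → E x (v i) → ∃ k, x ∈ H k)

section core

variable {X ι : Type*} {A : X → X → Prop} {κ : X → ι} {Inv : (X → X → Prop) → Prop}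

/-- If representatives can be chosen injectively, and every set meets two `F`-classes, then they
can be chosen not all `F`-equivalent. -/
theorem exists_injective_not_all_equiv {F : X → X → Prop} (hF : Equivalence F)
    (N : Fin 3 → Set X) (h2 : ∀ i, ∃ a ∈ N i, ∃ b ∈ N i, ¬ F a b)
    (w : Fin 3 → X) (hw : Function.Injective w) (hwN : ∀ i, w i ∈ N i) :
    ∃ w : Fin 3 → X, Function.Injective w ∧ (∀ i, w i ∈ N i) ∧ ¬ ∀ i j, F (w i) (w j) := by
  classical
  by_cases hall : ∀ i j, F (w i) (w j)
  swap
  · exact ⟨w, hw, hwN, hall⟩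
  obtain ⟨c, hc, hcF⟩ : ∃ c ∈ N 2, ¬ F (w 0) c := by
    obtain ⟨a, ha, b, hb, hab⟩ := h2 2
    by_cases h : F (w 0) a
    · exact ⟨b, hb, fun h' => hab (hF.trans (hF.symm h) h')⟩
    · exact ⟨a, ha, h⟩
  have hne : ∀ i, w i ≠ c := fun i h => hcF (h ▸ hall 0 i)
  refine ⟨Function.update w 2 c, ?_, ?_, ?_⟩
  · intro i j hij
    by_cases hi : i = 2 <;> by_cases hj : j = 2
    · rw [hi, hj]
    · subst hi; simp [Function.update_of_ne hj] at hij; exact absurd hij.symm (hne j)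
    · subst hj; simp [Function.update_of_ne hi] at hij; exact absurd hij (hne i)
    · rw [Function.update_of_ne hi, Function.update_of_ne hj] at hij; exact hw hij
  · intro i
    by_cases hi : i = 2
    · subst hi; simpa using hc
    · rw [Function.update_of_ne hi]; exact hwN i
  · intro h
    have := h 0 2
    simp at this
    exact hcF this

/-- The condition on triples over `d` under which they extend to good triples over an adjacent
fiber is void or is given by an invariant equivalence relation. -/
theorem exists_constraint [Finite X] (hI : HomogeneousRels A κ Inv)
    {d e : ι} {F : X → X → Prop} (hF : Equivalence F) (hFI : Inv F)
    (hFn : ∃ x y, κ x = e ∧ κ y = e ∧ ¬ F x y)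
    (h3 : ∃ f : Fin 3 → X, Function.Injective f ∧ ∀ i, κ (f i) = e)
    (h2 : ∀ x, κ x = d → ∃ y y', y ≠ y' ∧ A x y ∧ A x y' ∧ κ y = e ∧ κ y' = e)
    (h1 : ∀ y, κ y = e → ∃ x, A x y ∧ κ x = d) :
    (∀ v : Fin 3 → X, (∀ i, κ (v i) = d) → ∃ w : Fin 3 → X, Function.Injective w ∧
      (∀ i, A (v i) (w i) ∧ κ (w i) = e) ∧ ¬ ∀ i j, F (w i) (w j)) ∨
    ∃ E : X → X → Prop, Inv E ∧ Equivalence E ∧ (∃ x y, κ x = d ∧ κ y = d ∧ ¬ E x y) ∧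
      ∀ v : Fin 3 → X, (∀ i, κ (v i) = d) → (¬ ∀ i j, E (v i) (v j)) →
      ∃ w : Fin 3 → X, Function.Injective w ∧
      (∀ i, A (v i) (w i) ∧ κ (w i) = e) ∧ (¬ ∀ i j, F (w i) (w j)) ∧
      ∀ x i, κ x = d → E x (v i) → ∃ y, A x y ∧ κ y = e ∧ F y (w i) := by
  have h2N : ∀ x, κ x = d → ∃ a ∈ {y | A x y ∧ κ y = e}, ∃ b ∈ {y | A x y ∧ κ y = e}, a ≠ b := by
    intro x hx
    obtain ⟨y, y', hne, hy, hy', hye, hye'⟩ := h2 x hx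
    exact ⟨y, ⟨hy, hye⟩, y', ⟨hy', hye'⟩, hne⟩
  by_cases hP : ∃ x, κ x = d ∧ ∀ y y', A x y → κ y = e → A x y' → κ y' = e → F y y'
  · right
    have hP' : ∀ x, κ x = d → ∀ y y', A x y → κ y = e → A x y' → κ y' = e → F y y' := by
      obtain ⟨x₀, hx₀, hx₀F⟩ := hP
      intro x hx y y' hy hye hy' hye'
      by_contra hn
      have hM := hI.adj_fiber e
      have hR := hI.comp _ _ (hI.comp _ _ hM (hI.not _ hFI)) (hI.swap _ hM)
      obtain ⟨z, ⟨z', hz', hzF⟩, hz⟩ := hI.diag _ hR x x₀ (hx.trans hx₀.symm)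
        ⟨y', ⟨y, ⟨hy, hye⟩, hn⟩, ⟨hy', hye'⟩⟩
      exact hzF (hx₀F _ _ hz'.1 hz'.2 hz.1 hz.2)
    refine ⟨fun x x' => ∀ z, (∃ y, (A x y ∧ κ y = e) ∧ F y z) ↔ ∃ y, (A x' y ∧ κ y = e) ∧ F y z,
      hI.forall_iff (hI.comp _ _ (hI.adj_fiber e) hFI),
      ⟨fun _ _ => Iff.rfl, fun h z => (h z).symm, fun h h' z => (h z).trans (h' z)⟩, ?_, ?_⟩
    · obtain ⟨y, y', hy, hy', hyy⟩ := hFn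
      obtain ⟨x, hxy, hx⟩ := h1 y hy
      obtain ⟨x', hxy', hx'⟩ := h1 y' hy'
      refine ⟨x, x', hx, hx', fun h => ?_⟩
      obtain ⟨y'', hy'', hF''⟩ := (h y).1 ⟨y, ⟨hxy, hy⟩, hF.refl y⟩
      exact hyy (hF.trans (hF.symm hF'') (hP' x' hx' _ _ hy''.1 hy''.2 hxy' hy'))
    · intro v hv hne
      obtain ⟨w, hw, hwN⟩ := exists_injective_of_three (fun i => {y | A (v i) y ∧ κ y = e})
        (fun i => h2N _ (hv i)) (Or.inl fun h => hne fun i j z => by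
          have := h i j
          simp only [Set.ext_iff, Set.mem_ofPred_eq] at this
          simp only [this])
      refine ⟨w, hw, hwN, fun hall => hne fun i j z => ?_, ?_⟩
      · have aux : ∀ i j, (∃ y, (A (v i) y ∧ κ y = e) ∧ F y z) →
            ∃ y, (A (v j) y ∧ κ y = e) ∧ F y z := by
          rintro i j ⟨y, hy, hyz⟩
          exact ⟨w j, hwN j, hF.trans (hF.trans (hall j i)
            (hP' (v i) (hv i) _ _ (hwN i).1 (hwN i).2 hy.1 hy.2)) hyz⟩
        exact ⟨aux i j, aux j i⟩
      · intro x i _ hE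
        obtain ⟨y, hy, hyw⟩ := (hE (w i)).2 ⟨w i, hwN i, hF.refl _⟩
        exact ⟨y, hy.1, hy.2, hyw⟩
  · have hP' : ∀ x, κ x = d →
        ∃ a ∈ {y | A x y ∧ κ y = e}, ∃ b ∈ {y | A x y ∧ κ y = e}, ¬ F a b := by
      intro x hx
      by_contra hn
      exact hP ⟨x, hx, fun y y' hy hye hy' hye' => by_contra fun hF' =>
        hn ⟨y, ⟨hy, hye⟩, y', ⟨hy', hye'⟩, hF'⟩⟩
    by_cases htot : ∀ x x', κ x = d → κ x' = d →
        ∀ z, (A x z ∧ κ z = e) ↔ (A x' z ∧ κ z = e)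
    · left
      intro v hv
      obtain ⟨f, hf, hfe⟩ := h3
      obtain ⟨w, hw, hwN⟩ := exists_injective_of_three (fun i => {y | A (v i) y ∧ κ y = e})
        (fun i => h2N _ (hv i)) (Or.inr ⟨f, hf, fun k i => by
          obtain ⟨x, hxk, hx⟩ := h1 (f k) (hfe k)
          exact (htot x (v i) hx (hv i) (f k)).1 ⟨hxk, hfe k⟩⟩)
      exact exists_injective_not_all_equiv hF _ (fun i => hP' _ (hv i)) w hw hwN
    · right
      refine ⟨fun x x' => ∀ z, (A x z ∧ κ z = e) ↔ (A x' z ∧ κ z = e),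
        hI.forall_iff (hI.adj_fiber e),
        ⟨fun _ _ => Iff.rfl, fun h z => (h z).symm, fun h h' z => (h z).trans (h' z)⟩, ?_, ?_⟩
      · push Not at htot
        obtain ⟨x, x', hx, hx', z, hz⟩ := htot
        refine ⟨x, x', hx, hx', fun h => ?_⟩
        have := h z
        tauto
      · intro v hv hne
        obtain ⟨w, hw, hwN⟩ := exists_injective_of_three (fun i => {y | A (v i) y ∧ κ y = e})
          (fun i => h2N _ (hv i)) (Or.inl fun h => hne fun i j z => by
            have := h i j
            simp only [Set.ext_iff, Set.mem_ofPred_eq] at this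
            exact this z)
        obtain ⟨w, hw, hwN, hwF⟩ :=
          exists_injective_not_all_equiv hF _ (fun i => hP' _ (hv i)) w hw hwN
        refine ⟨w, hw, hwN, hwF, fun x i _ hE => ?_⟩
        have := (hE (w i)).2 (hwN i)
        exact ⟨w i, this.1, this.2, hF.refl _⟩

/-- Joining triples of connected sets over disjoint sets of fibers. -/
theorem exists_join (hA : ∀ x y, A x y → A y x) {U U' : Set ι} (hUU : Disjoint U U') {d : ι}
    (hd : d ∈ U) {H H' T : Fin 3 → Set X} {v p w : Fin 3 → X}
    (hH : ∀ i, RootedIn A (H i) (v i)) (hHd : ∀ i j x, x ∈ H i → x ∈ H j → i = j)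
    (hHU : ∀ i x, x ∈ H i → κ x ∈ U) (hHc : ∀ i x, κ x ∈ U → ∃ y ∈ H i, κ y = κ x)
    (hH' : ∀ i, RootedIn A (H' i) (w i)) (hHd' : ∀ i j x, x ∈ H' i → x ∈ H' j → i = j)
    (hHU' : ∀ i x, x ∈ H' i → κ x ∈ U') (hHc' : ∀ i x, κ x ∈ U' → ∃ y ∈ H' i, κ y = κ x)
    (hp : ∀ i, p i ∈ H i) (hpw : ∀ i, A (p i) (w i))
    (hT : ∀ i, ∀ x ∈ T i, κ x = d ∧ (∀ k, x ∉ H k) ∧ ∃ y ∈ H' i, A x y)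
    (hTd : ∀ i j x, x ∈ T i → x ∈ T j → i = j) :
    (∀ i, RootedIn A (H i ∪ H' i ∪ T i) (v i)) ∧
    (∀ i j x, x ∈ H i ∪ H' i ∪ T i → x ∈ H j ∪ H' j ∪ T j → i = j) ∧
    (∀ i x, x ∈ H i ∪ H' i ∪ T i → κ x ∈ U ∪ U') ∧
    (∀ i x, κ x ∈ U ∪ U' → ∃ y ∈ H i ∪ H' i ∪ T i, κ y = κ x) := by
  have hdis : ∀ k, k ∈ U → k ∈ U' → False := fun k h h' => Set.disjoint_left.1 hUU h h'
  have hTU : ∀ i x, x ∈ T i → κ x ∈ U := fun i x hx => by rw [(hT i x hx).1]; exact hd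
  refine ⟨fun i => (hH i).union hA (hH' i) (hp i) (hpw i) fun x hx => (hT i x hx).2.2, ?_, ?_, ?_⟩
  · rintro i j x ((h | h) | h) ((h' | h') | h')
    · exact hHd i j x h h'
    · exact (hdis _ (hHU _ _ h) (hHU' _ _ h')).elim
    · exact ((hT _ _ h').2.1 _ h).elim
    · exact (hdis _ (hHU _ _ h') (hHU' _ _ h)).elim
    · exact hHd' i j x h h'
    · exact (hdis _ (hTU _ _ h') (hHU' _ _ h)).elim
    · exact ((hT _ _ h).2.1 _ h').elim
    · exact (hdis _ (hTU _ _ h) (hHU' _ _ h')).elim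
    · exact hTd i j x h h'
  · rintro i x ((h | h) | h)
    · exact Or.inl (hHU _ _ h)
    · exact Or.inr (hHU' _ _ h)
    · exact Or.inl (hTU _ _ h)
  · rintro i x (h | h)
    · obtain ⟨y, hy, hyx⟩ := hHc i x h
      exact ⟨y, Or.inl (Or.inl hy), hyx⟩
    · obtain ⟨y, hy, hyx⟩ := hHc' i x h
      exact ⟨y, Or.inl (Or.inr hy), hyx⟩

theorem GoodRel.merge [Finite X] (hI : HomogeneousRels A κ Inv)
    (hA : ∀ x y, A x y → A y x) {d e : ι} {U U' : Set ι} {E F : X → X → Prop}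
    (hE : GoodRel A κ Inv U d E) (hF : GoodRel A κ Inv U' e F) (hUU : Disjoint U U')
    (hd : d ∈ U)
    (h3 : ∃ f : Fin 3 → X, Function.Injective f ∧ ∀ i, κ (f i) = e)
    (h2 : ∀ x, κ x = d → ∃ y y', y ≠ y' ∧ A x y ∧ A x y' ∧ κ y = e ∧ κ y' = e)
    (h1 : ∀ y, κ y = e → ∃ x, A x y ∧ κ x = d) :
    ∃ E', GoodRel A κ Inv (U ∪ U') d E' := by
  classical
  rcases exists_constraint hI hF.equiv hF.inv hF.nontotal h3 h2 h1 with
    hN | ⟨E', hE'I, hE', hE'n, hC⟩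
  · refine ⟨E, hE.inv, hE.equiv, hE.nontotal, fun v hv hvd hvE => ?_⟩
    obtain ⟨H, hH, hHd, hHU, hHc, hcov⟩ := hE.ext v hv hvd hvE
    obtain ⟨w, hw, hwN, hwF⟩ := hN v hvd
    obtain ⟨H', hH', hHd', hHU', hHc', -⟩ := hF.ext w hw (fun i => (hwN i).2) hwF
    obtain ⟨k1, k2, k3, k4⟩ := exists_join hA hUU hd (T := fun _ => ∅) hH hHd hHU hHc hH' hHd' hHU'
      hHc' (fun i => (hH i).1) (fun i => (hwN i).1) (by simp) (by simp)
    refine ⟨_, k1, k2, k3, k4, fun x i hx hxE => ?_⟩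
    obtain ⟨k, hk⟩ := hcov x i hx hxE
    exact ⟨k, Or.inl (Or.inl hk)⟩
  by_cases hle : ∀ x y, κ x = d → κ y = d → E x y → E' x y
  · refine ⟨E', hE'I, hE', hE'n, fun v hv hvd hvE => ?_⟩
    obtain ⟨H, hH, hHd, hHU, hHc, -⟩ := hE.ext v hv hvd
      fun h => hvE fun i j => hle _ _ (hvd i) (hvd j) (h i j)
    obtain ⟨w, hw, hwN, hwF, hwx⟩ := hC v hvd hvE
    obtain ⟨H', hH', hHd', hHU', hHc', hcov⟩ := hF.ext w hw (fun i => (hwN i).2) hwF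
    have hch : ∀ x, ∃ k : Fin 3, (∃ i, κ x = d ∧ E' x (v i)) → ∃ y ∈ H' k, A x y := by
      intro x
      by_cases h : ∃ i, κ x = d ∧ E' x (v i)
      · obtain ⟨i, hx, hxE⟩ := h
        obtain ⟨y, hxy, hy, hyF⟩ := hwx x i hx hxE
        obtain ⟨k, hk⟩ := hcov y i hy hyF
        exact ⟨k, fun _ => ⟨y, hk, hxy⟩⟩
      · exact ⟨0, fun h' => (h h').elim⟩
    choose a ha using hch
    obtain ⟨k1, k2, k3, k4⟩ := exists_join hA hUU hd
      (T := fun k => {x | (∃ i, κ x = d ∧ E' x (v i)) ∧ (∀ k, x ∉ H k) ∧ a x = k})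
      hH hHd hHU hHc hH' hHd' hHU'
      hHc' (fun i => (hH i).1) (fun i => (hwN i).1)
      (by
        rintro i x ⟨⟨j, hx, hxE⟩, hxH, rfl⟩
        exact ⟨hx, hxH, ha x ⟨j, hx, hxE⟩⟩)
      (by
        rintro i j x ⟨-, -, rfl⟩ ⟨-, -, rfl⟩
        rfl)
    refine ⟨_, k1, k2, k3, k4, fun x i hx hxE => ?_⟩
    by_cases h : ∃ k, x ∈ H k
    · obtain ⟨k, hk⟩ := h
      exact ⟨k, Or.inl (Or.inl hk)⟩
    · push Not at h
      exact ⟨a x, Or.inr ⟨⟨i, hx, hxE⟩, h, rfl⟩⟩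
  · refine ⟨E, hE.inv, hE.equiv, hE.nontotal, fun v hv hvd hvE => ?_⟩
    obtain ⟨H, hH, hHd, hHU, hHc, hcov⟩ := hE.ext v hv hvd hvE
    obtain ⟨p, hpH, hpd, hpE⟩ : ∃ p : Fin 3 → X, (∀ i, p i ∈ H i) ∧ (∀ i, κ (p i) = d) ∧
        ¬ ∀ i j, E' (p i) (p j) := by
      by_cases hall : ∀ i j, E' (v i) (v j)
      swap
      · exact ⟨v, fun i => (hH i).1, hvd, hall⟩
      push Not at hle
      obtain ⟨x, y, hx, hy, hxy, hxy'⟩ := hle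
      obtain ⟨z, ⟨hz, hz'⟩, hzd⟩ := hI.exists_of_exists
        (hI.and _ _ (hI.and _ _ hE.inv (hI.not _ hE'I)) (hI.swap _ (hI.fiber d)))
        (hx.trans (hvd 0).symm) ⟨⟨hxy, hxy'⟩, hy⟩
      obtain ⟨k, hk⟩ := hcov z 0 hzd (hE.equiv.symm hz)
      refine ⟨Function.update v k z, fun i => ?_, fun i => ?_, fun h => ?_⟩
      · by_cases hi : i = k
        · subst hi; simpa using hk
        · rw [Function.update_of_ne hi]; exact (hH i).1
      · by_cases hi : i = k
        · subst hi; simpa using hzd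
        · rw [Function.update_of_ne hi]; exact hvd i
      · obtain ⟨j, hj⟩ := exists_ne k
        have := h j k
        rw [Function.update_of_ne hj, Function.update_self] at this
        exact hz' (hE'.trans (hall 0 j) this)
    obtain ⟨w, hw, hwN, hwF, -⟩ := hC p hpd hpE
    obtain ⟨H', hH', hHd', hHU', hHc', -⟩ := hF.ext w hw (fun i => (hwN i).2) hwF
    obtain ⟨k1, k2, k3, k4⟩ := exists_join hA hUU hd (T := fun _ => ∅) hH hHd hHU hHc hH' hHd' hHU'
      hHc' hpH (fun i => (hwN i).1) (by simp) (by simp)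
    refine ⟨_, k1, k2, k3, k4, fun x i hx hxE => ?_⟩
    obtain ⟨k, hk⟩ := hcov x i hx hxE
    exact ⟨k, Or.inl (Or.inl hk)⟩

theorem GoodRel.singleton (hI : HomogeneousRels A κ Inv) (d : ι)
    (h3 : ∃ f : Fin 3 → X, Function.Injective f ∧ ∀ i, κ (f i) = d) :
    GoodRel A κ Inv {d} d (fun x y => x = y) := by
  refine ⟨hI.eq, ⟨fun _ => rfl, fun h => h.symm, fun h h' => h.trans h'⟩, ?_, ?_⟩
  · obtain ⟨f, hf, hfd⟩ := h3
    exact ⟨f 0, f 1, hfd 0, hfd 1, fun h => absurd (hf h) (by decide)⟩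
  · intro v hv hvd _
    refine ⟨fun i => {v i}, fun i => ⟨rfl, ?_⟩, ?_, ?_, ?_, ?_⟩
    · rintro x rfl; exact Relation.ReflTransGen.refl
    · rintro i j x rfl h; exact hv h
    · rintro i x rfl; exact hvd i
    · rintro i x hx; exact ⟨v i, rfl, (hvd i).trans hx.symm⟩
    · rintro x i _ rfl; exact ⟨i, rfl⟩

/-- Finite rooted trees in the relation `B`, recorded by root and vertex set. -/
inductive SpansTree {ι : Type*} (B : ι → ι → Prop) : ι → Set ι → Prop
  | single (d : ι) : SpansTree B d {d}
  | merge {d e : ι} {U U' : Set ι} : SpansTree B d U → SpansTree B e U' → Disjoint U U' →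
      B d e → SpansTree B d (U ∪ U')

theorem SpansTree.root_mem {B : ι → ι → Prop} {d : ι} {U : Set ι} (h : SpansTree B d U) :
    d ∈ U := by
  induction h with
  | single d => rfl
  | merge _ _ _ _ ih _ => exact Or.inl ih

theorem SpansTree.add_leaf {B : ι → ι → Prop} {d : ι} {U : Set ι} (h : SpansTree B d U)
    {x y : ι} (hx : x ∈ U) (hy : y ∉ U) (hxy : B x y) : SpansTree B d (U ∪ {y}) := by
  induction h with
  | single d =>
    obtain rfl : x = d := hx
    exact (SpansTree.single x).merge (SpansTree.single y)
      (Set.disjoint_singleton_right.2 hy) hxy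
  | @merge d e U U' h h' hUU hde ih ih' =>
    have hyU : y ∉ U := fun h => hy (Or.inl h)
    have hyU' : y ∉ U' := fun h => hy (Or.inr h)
    rcases hx with hx | hx
    · rw [Set.union_right_comm]
      exact (ih hx hyU).merge h' (Set.disjoint_union_left.2
        ⟨hUU, Set.disjoint_singleton_left.2 hyU'⟩) hde
    · rw [Set.union_assoc]
      exact h.merge (ih' hx hyU') (Set.disjoint_union_right.2
        ⟨hUU, Set.disjoint_singleton_right.2 hyU⟩) hde

/-- Three disjoint connected sets meeting every fiber. -/
theorem exists_three_connected_of_homogeneous [Finite X] [Nonempty X]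
    (hI : HomogeneousRels A κ Inv) (hA : ∀ x y, A x y → A y x)
    (h3 : ∀ x, ∃ f : Fin 3 → X, Function.Injective f ∧ ∀ i, κ (f i) = κ x)
    (h2 : ∀ x y, A x y → κ x ≠ κ y → ∀ x', κ x' = κ x →
      ∃ z z', z ≠ z' ∧ A x' z ∧ A x' z' ∧ κ z = κ y ∧ κ z' = κ y)
    (hconn : ∀ U : Set ι, (∃ x, κ x ∈ U) → (∃ x, κ x ∉ U) → ∃ x y, A x y ∧ κ x ∈ U ∧ κ y ∉ U) :
    ∃ (H : Fin 3 → Set X) (v : Fin 3 → X), (∀ i, RootedIn A (H i) (v i)) ∧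
      (∀ i j x, x ∈ H i → x ∈ H j → i = j) ∧ ∀ i x, ∃ y ∈ H i, κ y = κ x := by
  classical
  obtain ⟨x₀⟩ := ‹Nonempty X›
  let B : ι → ι → Prop := fun i j => i ≠ j ∧ ∃ x y, A x y ∧ κ x = i ∧ κ y = j
  have hgood : ∀ d U, SpansTree B d U → (∃ x, κ x = d) → ∃ E, GoodRel A κ Inv U d E := by
    intro d U h
    induction h with
    | single d =>
      rintro ⟨x, rfl⟩
      exact ⟨_, GoodRel.singleton hI _ (h3 x)⟩
    | @merge d e U U' h h' hUU hde ih ih' =>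
      intro hd
      obtain ⟨hne, x, y, hxy, rfl, rfl⟩ := hde
      obtain ⟨E, hE⟩ := ih hd
      obtain ⟨F, hF⟩ := ih' ⟨y, rfl⟩
      refine hE.merge hI hA hF hUU h.root_mem (h3 y) (h2 x y hxy hne) fun z hz => ?_
      obtain ⟨a, -, -, ha, -, ha', -⟩ := h2 y x (hA _ _ hxy) hne.symm z hz
      exact ⟨a, hA _ _ ha, ha'⟩
  have hspan : ∃ U, SpansTree B (κ x₀) U ∧ ∀ x, κ x ∈ U := by
    obtain ⟨S, ⟨U, hU, rfl⟩, hmax⟩ := (Set.toFinite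
      {S : Set X | ∃ U, SpansTree B (κ x₀) U ∧ S = κ ⁻¹' U}).exists_maximal
      ⟨_, _, SpansTree.single (κ x₀), rfl⟩
    refine ⟨U, hU, ?_⟩
    by_contra hn
    push Not at hn
    obtain ⟨x, y, hxy, hx, hy⟩ := hconn U ⟨x₀, hU.root_mem⟩ hn
    have := hmax ⟨_, hU.add_leaf hx hy ⟨fun h => hy (h ▸ hx), x, y, hxy, rfl, rfl⟩, rfl⟩
      (Set.preimage_mono Set.subset_union_left) (show y ∈ _ from Or.inr rfl)
    exact hy this
  obtain ⟨U, hU, hall⟩ := hspan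
  obtain ⟨E, hE⟩ := hgood _ U hU ⟨x₀, rfl⟩
  obtain ⟨f, hf, hfx⟩ := h3 x₀
  obtain ⟨a, b, ha, hb, hab⟩ := hE.nontotal
  obtain ⟨v, hv, hvd, hvE⟩ : ∃ v : Fin 3 → X, Function.Injective v ∧ (∀ i, v i ∈ {x | κ x = κ x₀}) ∧
      ¬ ∀ i j, E (v i) (v j) :=
    exists_injective_not_all_equiv hE.equiv _ (fun i => ⟨a, ha, b, hb, hab⟩) f hf hfx
  obtain ⟨H, k1, k2, -, k4, -⟩ := hE.ext v hv hvd hvE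
  exact ⟨H, v, k1, k2, fun i x => k4 i x (hall x)⟩

end core

/-- Equally colored pairs agree on equality, adjacency and the set of colors of their
extensions by a third vertex. -/
def IsTriangleStable {V C : Type*} (G : SimpleGraph V) (χ : V → V → C) : Prop :=
  ∀ u v u' v' : V, χ u v = χ u' v' →
    (u = v ↔ u' = v') ∧ (G.Adj u v ↔ G.Adj u' v') ∧
    ∀ w, ∃ w', χ u w = χ u' w' ∧ χ w v = χ w' v'

/-- The relation `R` only depends on the color of the pair. -/
def ColorInvariant {V C : Type*} (χ : V → V → C) (R : V → V → Prop) : Prop :=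
  ∀ u v u' v' : V, χ u v = χ u' v' → R u v → R u' v'

section stable

variable {V C : Type*} {G : SimpleGraph V} {χ : V → V → C}

theorem IsTriangleStable.right (hχ : IsTriangleStable G χ) {u v u' v' : V}
    (h : χ u v = χ u' v') : χ v v = χ v' v' := by
  obtain ⟨w, -, hw⟩ := (hχ _ _ _ _ h).2.2 v
  have := (hχ _ _ _ _ hw).1.1 rfl
  rwa [this] at hw

theorem IsTriangleStable.left (hχ : IsTriangleStable G χ) {u v u' v' : V}
    (h : χ u v = χ u' v') : χ u u = χ u' u' := by
  obtain ⟨w, hw, -⟩ := (hχ _ _ _ _ h).2.2 u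
  have := (hχ _ _ _ _ hw).1.1 rfl
  rwa [← this] at hw

theorem IsTriangleStable.exists_pair (hχ : IsTriangleStable G χ) {u u' : V}
    (h : χ u u = χ u' u') (v : V) : ∃ v', χ u v = χ u' v' := by
  obtain ⟨w, hw, -⟩ := (hχ _ _ _ _ h).2.2 v
  exact ⟨w, hw⟩

theorem ColorInvariant.not {R : V → V → Prop} (hR : ColorInvariant χ R) :
    ColorInvariant χ (fun u v => ¬ R u v) :=
  fun _ _ _ _ h hn hr => hn (hR _ _ _ _ h.symm hr)

theorem ColorInvariant.and {R S : V → V → Prop} (hR : ColorInvariant χ R)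
    (hS : ColorInvariant χ S) : ColorInvariant χ (fun u v => R u v ∧ S u v) :=
  fun _ _ _ _ h hn => ⟨hR _ _ _ _ h hn.1, hS _ _ _ _ h hn.2⟩

theorem ColorInvariant.or {R S : V → V → Prop} (hR : ColorInvariant χ R)
    (hS : ColorInvariant χ S) : ColorInvariant χ (fun u v => R u v ∨ S u v) :=
  fun _ _ _ _ h hn => hn.imp (hR _ _ _ _ h) (hS _ _ _ _ h)

theorem ColorInvariant.comp (hχ : IsTriangleStable G χ) {R S : V → V → Prop}
    (hR : ColorInvariant χ R) (hS : ColorInvariant χ S) :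
    ColorInvariant χ (fun u v => ∃ w, R u w ∧ S w v) := by
  rintro u v u' v' h ⟨w, h1, h2⟩
  obtain ⟨w', hw, hw'⟩ := (hχ _ _ _ _ h).2.2 w
  exact ⟨w', hR _ _ _ _ hw h1, hS _ _ _ _ hw' h2⟩

theorem ColorInvariant.reachable (hχ : IsTriangleStable G χ) {L : SimpleGraph V}
    (hL : ColorInvariant χ L.Adj) : ColorInvariant χ L.Reachable := by
  rintro u v u' v' h ⟨p⟩
  induction p generalizing u' v' with
  | nil =>
    have := (hχ _ _ _ _ h).1.1 rfl
    rw [this]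
  | @cons u w v hadj p ih =>
    obtain ⟨w', hw, hw'⟩ := (hχ _ _ _ _ h).2.2 w
    exact (hL _ _ _ _ hw hadj).reachable.trans (ih _ _ hw')

/-- The vertex colors occurring in a component of `L`. -/
def componentColors (χ : V → V → C) {L : SimpleGraph V} (x : L.ConnectedComponent) : Set C :=
  {c | ∃ u, L.connectedComponentMk u = x ∧ χ u u = c}

theorem mem_componentColors (χ : V → V → C) (L : SimpleGraph V) (v : V) :
    χ v v ∈ componentColors χ (L.connectedComponentMk v) := ⟨v, rfl, rfl⟩

theorem componentColors_eq (hχ : IsTriangleStable G χ) {L : SimpleGraph V}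
    (hL : ColorInvariant χ L.Adj) {u v : V} (h : χ u u = χ v v) :
    componentColors χ (L.connectedComponentMk u) = componentColors χ (L.connectedComponentMk v) := by
  have key : ∀ u v : V, χ u u = χ v v → componentColors χ (L.connectedComponentMk u) ⊆
      componentColors χ (L.connectedComponentMk v) := by
    rintro u v h _ ⟨w, hw, rfl⟩
    obtain ⟨w', hw'⟩ := hχ.exists_pair h w
    refine ⟨w', ?_, (hχ.right hw').symm⟩
    rw [SimpleGraph.ConnectedComponent.eq] at hw ⊢
    exact (ColorInvariant.reachable hχ hL _ _ _ _ hw' hw.symm).symm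
  exact (key _ _ h).antisymm (key _ _ h.symm)

theorem colorInvariant_of_left (hχ : IsTriangleStable G χ) {P : V → Prop}
    (hP : ∀ u v, χ u u = χ v v → P u → P v) : ColorInvariant χ (fun u _ => P u) :=
  fun _ _ _ _ h => hP _ _ (hχ.left h)

theorem colorInvariant_of_right (hχ : IsTriangleStable G χ) {P : V → Prop}
    (hP : ∀ u v, χ u u = χ v v → P u → P v) : ColorInvariant χ (fun _ v => P v) :=
  fun _ _ _ _ h => hP _ _ (hχ.right h)

/-- An invariant subgraph such that each vertex color occurs in at least three components. -/
structure IsSplitting (G : SimpleGraph V) (χ : V → V → C) (L : SimpleGraph V) : Prop where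
  le : L ≤ G
  inv : ColorInvariant χ L.Adj
  three : ∀ v, ∃ f : Fin 3 → V, (∀ i, χ (f i) (f i) = χ v v) ∧
    ∀ i j, L.Reachable (f i) (f j) → i = j

/-- Groups of components `I` and `J` such that each component in `I` has a unique neighbor in `J`
can be merged. -/
theorem IsSplitting.exists_lt (hχ : IsTriangleStable G χ) {L : SimpleGraph V}
    (hL : IsSplitting G χ L) {I J : Set C} (hIJ : I ≠ J)
    {a b : V} (hab : G.Adj a b) (ha : componentColors χ (L.connectedComponentMk a) = I)
    (hb : componentColors χ (L.connectedComponentMk b) = J)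
    (hex : ∀ u, componentColors χ (L.connectedComponentMk u) = I → ∃ u' v, L.Reachable u u' ∧
      G.Adj u' v ∧ componentColors χ (L.connectedComponentMk v) = J)
    (huniq : ∀ u u' v v', componentColors χ (L.connectedComponentMk u) = I → L.Reachable u u' →
      G.Adj u v → G.Adj u' v' → componentColors χ (L.connectedComponentMk v) = J →
      componentColors χ (L.connectedComponentMk v') = J → L.Reachable v v') :
    ∃ L', IsSplitting G χ L' ∧ L < L' := by
  classical
  let κ : V → Set C := fun v => componentColors χ (L.connectedComponentMk v)
  have hκ : ∀ u v, L.Reachable u v → κ u = κ v := fun u v h => by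
    simp only [κ]; rw [SimpleGraph.ConnectedComponent.sound h]
  have hκc : ∀ u v, χ u u = χ v v → κ u = κ v := fun u v h => componentColors_eq hχ hL.inv h
  let L' : SimpleGraph V :=
    { Adj := fun u v => L.Adj u v ∨
        (G.Adj u v ∧ ((κ u = I ∧ κ v = J) ∨ (κ u = J ∧ κ v = I)))
      symm := ⟨fun u v h => h.imp (fun h => h.symm) fun h => ⟨h.1.symm, h.2.elim
        (fun h => Or.inr ⟨h.2, h.1⟩) (fun h => Or.inl ⟨h.2, h.1⟩)⟩⟩
      loopless := ⟨fun u h => h.elim (fun h => L.loopless.irrefl u h)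
        (fun h => G.loopless.irrefl u h.1)⟩ }
  have hLL' : L ≤ L' := fun u v h => Or.inl h
  have hinv : ColorInvariant χ L'.Adj := by
    have hl : ∀ K, ColorInvariant χ (fun u _ => κ u = K) := fun K =>
      colorInvariant_of_left hχ fun u v h hu => (hκc u v h).symm.trans hu
    have hr : ∀ K, ColorInvariant χ (fun _ v => κ v = K) := fun K =>
      colorInvariant_of_right hχ fun u v h hu => (hκc u v h).symm.trans hu
    exact hL.inv.or (ColorInvariant.and (fun _ _ _ _ h => (hχ _ _ _ _ h).2.1.1)
      (((hl I).and (hr J)).or ((hl J).and (hr I))))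
  let φ : V → Set V := fun u => if κ u = I then
    {x | ∃ u' v, L.Reachable u u' ∧ G.Adj u' v ∧ κ v = J ∧ L.Reachable v x} else
    {x | L.Reachable u x}
  have hcross : ∀ u v, G.Adj u v → κ u = I → κ v = J → φ u = φ v := by
    intro u v huv hu hv
    have hv' : κ v ≠ I := fun h => hIJ (h.symm.trans hv)
    simp only [φ, if_pos hu, if_neg hv']
    ext x
    constructor
    · rintro ⟨u', v', hu', huv', hv'', hx⟩
      exact (huniq u u' v v' hu hu' huv huv' hv hv'').trans hx
    · intro hx
      exact ⟨u, v, SimpleGraph.Reachable.refl u, huv, hv, hx⟩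
  have hφ : ∀ u v, L'.Reachable u v → φ u = φ v := by
    rintro u v ⟨p⟩
    induction p with
    | nil => rfl
    | @cons u w v hadj p ih =>
      refine Eq.trans ?_ ih
      rcases hadj with h | ⟨h, ⟨h1, h2⟩ | ⟨h1, h2⟩⟩
      · have hr := h.reachable
        have : ∀ x, L.Reachable u x ↔ L.Reachable w x := fun x =>
          ⟨fun h => hr.symm.trans h, fun h => hr.trans h⟩
        simp only [φ, hκ u w hr, this]
      · exact hcross u w h h1 h2
      · exact (hcross w u h.symm h2 h1).symm
  have hthree : ∀ v, κ v ≠ I → ∃ f : Fin 3 → V, (∀ i, χ (f i) (f i) = χ v v) ∧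
      ∀ i j, L'.Reachable (f i) (f j) → i = j := by
    intro v hv
    obtain ⟨f, hf, hfr⟩ := hL.three v
    refine ⟨f, hf, fun i j h => hfr i j ?_⟩
    have h1 : ∀ i, κ (f i) ≠ I := fun i => by rw [hκc _ _ (hf i)]; exact hv
    have h2 := hφ _ _ h
    simp only [φ, if_neg (h1 _)] at h2
    have : f j ∈ {x | L.Reachable (f j) x} := SimpleGraph.Reachable.refl _
    rw [← h2] at this
    exact this
  refine ⟨L', ⟨fun u v h => h.elim (fun h => hL.le h) (fun h => h.1), hinv, fun v => ?_⟩,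
    lt_of_le_not_ge hLL' fun h => ?_⟩
  · by_cases hv : κ v = I
    swap
    · exact hthree v hv
    obtain ⟨u', y, hu', huy, hy⟩ := hex v hv
    have hyv : L'.Reachable y v := by
      have h1 : L'.Adj u' y := Or.inr ⟨huy, Or.inl ⟨(hκ _ _ hu').symm.trans hv, hy⟩⟩
      exact ((hu'.mono hLL').trans h1.reachable).symm
    obtain ⟨f, hf, hfr⟩ := hthree y fun h => hIJ (h.symm.trans hy)
    choose g hg using fun i => hχ.exists_pair (hf i).symm v
    have hfg : ∀ i, L'.Reachable (f i) (g i) := fun i =>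
      ColorInvariant.reachable hχ hinv _ _ _ _ (hg i) hyv
    exact ⟨g, fun i => (hχ.right (hg i)).symm, fun i j h =>
      hfr i j (((hfg i).trans h).trans (hfg j).symm)⟩
  · have h1 : L.Adj a b := h (Or.inr ⟨hab, Or.inl ⟨ha, hb⟩⟩)
    exact hIJ ((ha.symm.trans (hκ _ _ h1.reachable)).trans hb)

/-- Adjacency of components. -/
def componentAdj (G L : SimpleGraph V) (x y : L.ConnectedComponent) : Prop :=
  ∃ u v, L.connectedComponentMk u = x ∧ L.connectedComponentMk v = y ∧ G.Adj u v

theorem homogeneousRels_components (hχ : IsTriangleStable G χ) {L : SimpleGraph V}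
    (hL : ColorInvariant χ L.Adj) :
    HomogeneousRels (componentAdj G L) (componentColors χ)
      (fun R => ColorInvariant χ
          (fun u v => R (L.connectedComponentMk u) (L.connectedComponentMk v)) ∧
        ColorInvariant χ
          (fun u v => R (L.connectedComponentMk v) (L.connectedComponentMk u))) := by
  have hreach := ColorInvariant.reachable hχ hL
  have hfib : ∀ K : Set C, ∀ u v, χ u u = χ v v →
      componentColors χ (L.connectedComponentMk u) = K →
      componentColors χ (L.connectedComponentMk v) = K := fun K u v h hu =>
    (componentColors_eq hχ hL h).symm.trans hu
  have hcomp : ∀ R S : L.ConnectedComponent → L.ConnectedComponent → Prop,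
      ColorInvariant χ (fun u v => R (L.connectedComponentMk u) (L.connectedComponentMk v)) →
      ColorInvariant χ (fun u v => S (L.connectedComponentMk u) (L.connectedComponentMk v)) →
      ColorInvariant χ (fun u v => ∃ z, R (L.connectedComponentMk u) z ∧
        S z (L.connectedComponentMk v)) := by
    intro R S hR hS
    have := ColorInvariant.comp hχ hR hS
    convert this using 3 with u v
    constructor
    · rintro ⟨z, hz⟩
      induction z using SimpleGraph.ConnectedComponent.ind with | h w => exact ⟨w, hz⟩
    · rintro ⟨w, hw⟩
      exact ⟨_, hw⟩
  have hadj : ColorInvariant χ (fun u v =>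
      componentAdj G L (L.connectedComponentMk u) (L.connectedComponentMk v)) := by
    have := ColorInvariant.comp hχ (ColorInvariant.comp hχ hreach
      (fun _ _ _ _ h => (hχ _ _ _ _ h).2.1.1 : ColorInvariant χ G.Adj)) hreach
    convert this using 3 with u v
    constructor
    · rintro ⟨u', v', hu, hv, h⟩
      rw [SimpleGraph.ConnectedComponent.eq] at hu hv
      exact ⟨v', ⟨u', hu.symm, h⟩, hv⟩
    · rintro ⟨v', ⟨u', hu, h⟩, hv⟩
      exact ⟨u', v', SimpleGraph.ConnectedComponent.sound hu.symm,
        SimpleGraph.ConnectedComponent.sound hv, h⟩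
  have hsymm : ∀ x y, componentAdj G L x y → componentAdj G L y x :=
    fun x y ⟨u, v, hu, hv, h⟩ => ⟨v, u, hv, hu, h.symm⟩
  have hreach' : ColorInvariant χ (fun u v =>
      L.connectedComponentMk u = L.connectedComponentMk v) := by
    simpa only [SimpleGraph.ConnectedComponent.eq] using hreach
  refine ⟨⟨hreach', ?_⟩, ⟨hadj, ?_⟩, fun K => ⟨?_, ?_⟩, fun R hR => ⟨hR.1.not, hR.2.not⟩,
    fun R S hR hS => ⟨hR.1.and hS.1, hR.2.and hS.2⟩, fun R S hR hS => ⟨hcomp R S hR.1 hS.1, ?_⟩,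
    fun R hR => ⟨hR.2, hR.1⟩, ?_⟩
  · simpa only [eq_comm] using hreach'
  · exact fun u v u' v' h h' => hsymm _ _ (hadj _ _ _ _ h (hsymm _ _ h'))
  · exact colorInvariant_of_left hχ (hfib K)
  · exact colorInvariant_of_right hχ (hfib K)
  · have := hcomp (fun x y => S y x) (fun x y => R y x) hS.2 hR.2
    simpa only [and_comm] using this
  · intro R hR x x' hx hxx
    induction x using SimpleGraph.ConnectedComponent.ind with | h u => ?_
    have := mem_componentColors χ L u
    rw [hx] at this
    obtain ⟨u', rfl, hu'⟩ := this
    exact hR.1 u u u' u' hu'.symm hxx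

theorem RootedIn.preimage_components {L : SimpleGraph V} (hLG : L ≤ G)
    {S : Set L.ConnectedComponent} {r : V}
    (hS : RootedIn (componentAdj G L) S (L.connectedComponentMk r)) :
    RootedIn G.Adj (L.connectedComponentMk ⁻¹' S) r := by
  refine ⟨hS.1, ?_⟩
  have hin : ∀ u v, L.Reachable u v → L.connectedComponentMk u ∈ S → Relation.ReflTransGen
      (fun a b => G.Adj a b ∧ a ∈ L.connectedComponentMk ⁻¹' S ∧
        b ∈ L.connectedComponentMk ⁻¹' S) u v := by
    rintro u v ⟨p⟩ hu
    induction p with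
    | nil => exact Relation.ReflTransGen.refl
    | @cons u w v hadj p ih =>
      have hw : L.connectedComponentMk w ∈ S := by
        rwa [← SimpleGraph.ConnectedComponent.sound hadj.reachable]
      exact Relation.ReflTransGen.head ⟨hLG hadj, hu, hw⟩ (ih hw)
  have key : ∀ x, Relation.ReflTransGen (fun a b => componentAdj G L a b ∧ a ∈ S ∧ b ∈ S)
      (L.connectedComponentMk r) x → ∀ v, L.connectedComponentMk v = x → Relation.ReflTransGen
      (fun a b => G.Adj a b ∧ a ∈ L.connectedComponentMk ⁻¹' S ∧
        b ∈ L.connectedComponentMk ⁻¹' S) r v := by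
    intro x hx
    induction hx with
    | refl => exact fun v hv => hin _ _ (SimpleGraph.ConnectedComponent.exact hv.symm) hS.1
    | @tail y z hy hz ih =>
      rintro v rfl
      obtain ⟨⟨a, b, rfl, hb, hab⟩, ha', hv'⟩ := hz
      have hb' : L.connectedComponentMk b ∈ S := by rwa [hb]
      exact ((ih a rfl).tail ⟨hab, ha', hb'⟩).trans
        (hin _ _ (SimpleGraph.ConnectedComponent.exact hb) hb')
  exact fun v hv => key _ (hS.2 _ hv) v rfl

/-- If all vertex colors occur at least three times and the colors are connected in `G`, then
there are three disjoint connected sets meeting all vertex color classes. -/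
theorem exists_three_connected_of_stable [Finite V] [Nonempty V] (hχ : IsTriangleStable G χ)
    (hthree : ∀ v, ∃ f : Fin 3 → V, Function.Injective f ∧ ∀ i, χ (f i) (f i) = χ v v)
    (hconn : ∀ S : Set V, S.Nonempty → (∀ u v, χ u u = χ v v → u ∈ S → v ∈ S) →
      (∀ u v, G.Adj u v → u ∈ S → v ∈ S) → S = Set.univ) :
    ∃ (H : Fin 3 → Set V) (r : Fin 3 → V), (∀ i, RootedIn G.Adj (H i) (r i)) ∧
      (∀ i j x, x ∈ H i → x ∈ H j → i = j) ∧ ∀ i x, ∃ y ∈ H i, χ y y = χ x x := by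
  classical
  have hbot : IsSplitting G χ ⊥ := by
    refine ⟨bot_le, fun _ _ _ _ _ h => h.elim, fun v => ?_⟩
    obtain ⟨f, hf, hfv⟩ := hthree v
    exact ⟨f, hfv, fun i j h => hf (by simpa using h)⟩
  obtain ⟨L, hL, hmax⟩ := (Set.toFinite {L | IsSplitting G χ L}).exists_maximal ⟨⊥, hbot⟩
  obtain ⟨Inv, hI⟩ : ∃ Inv, HomogeneousRels (componentAdj G L) (componentColors χ) Inv :=
    ⟨_, homogeneousRels_components hχ hL.inv⟩
  have hsymm : ∀ x y, componentAdj G L x y → componentAdj G L y x :=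
    fun x y ⟨u, v, hu, hv, h⟩ => ⟨v, u, hv, hu, h.symm⟩
  have h3 : ∀ x : L.ConnectedComponent, ∃ f : Fin 3 → L.ConnectedComponent, Function.Injective f ∧
      ∀ i, componentColors χ (f i) = componentColors χ x := by
    intro x
    induction x using SimpleGraph.ConnectedComponent.ind with | h v => ?_
    obtain ⟨f, hf, hfr⟩ := hL.three v
    exact ⟨fun i => L.connectedComponentMk (f i),
      fun i j h => hfr i j (SimpleGraph.ConnectedComponent.exact h),
      fun i => componentColors_eq hχ hL.inv (hf i)⟩
  have h2 : ∀ x y : L.ConnectedComponent, componentAdj G L x y →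
      componentColors χ x ≠ componentColors χ y → ∀ x', componentColors χ x' = componentColors χ x →
      ∃ z z', z ≠ z' ∧ componentAdj G L x' z ∧ componentAdj G L x' z' ∧
        componentColors χ z = componentColors χ y ∧ componentColors χ z' = componentColors χ y := by
    intro x y hxy hne x' hx'
    by_contra hn
    push Not at hn
    have hone : ∀ z, componentColors χ z = componentColors χ x → ∀ w w', componentAdj G L z w →
        componentAdj G L z w' → componentColors χ w = componentColors χ y →
        componentColors χ w' = componentColors χ y → w = w' := by
      intro z hz w w' hw hw' hwy hwy'
      by_contra hne'
      have hM := hI.adj_fiber (componentColors χ y)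
      obtain ⟨a, ⟨b, hb, hba⟩, ha⟩ := hI.diag _
        (hI.comp _ _ (hI.comp _ _ hM (hI.not _ hI.eq)) (hI.swap _ hM)) z x' (hz.trans hx'.symm)
        ⟨w', ⟨w, ⟨hw, hwy⟩, hne'⟩, ⟨hw', hwy'⟩⟩
      exact hn b a hba hb.1 ha.1 hb.2 ha.2
    obtain ⟨a, b, rfl, rfl, hab⟩ := hxy
    obtain ⟨L', hL', hlt⟩ := hL.exists_lt hχ hne hab rfl rfl
      (by
        intro u hu
        obtain ⟨w, ⟨u', v, hu', rfl, huv⟩, hw⟩ := hI.exists_of_exists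
          (hI.adj_fiber (componentColors χ (L.connectedComponentMk b))) hu.symm
          ⟨⟨a, b, rfl, rfl, hab⟩, rfl⟩
        exact ⟨u', v, (SimpleGraph.ConnectedComponent.exact hu').symm, huv, hw⟩)
      (by
        intro u u' v v' hu huu' huv huv' hv hv'
        exact SimpleGraph.ConnectedComponent.exact (hone _ hu _ _ ⟨u, v, rfl, rfl, huv⟩
          ⟨u', v', SimpleGraph.ConnectedComponent.sound huu'.symm, rfl, huv'⟩ hv hv'))
    exact hlt.not_ge (hmax hL' hlt.le)
  have h1 : ∀ U : Set (Set C), (∃ x : L.ConnectedComponent, componentColors χ x ∈ U) →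
      (∃ x : L.ConnectedComponent, componentColors χ x ∉ U) →
      ∃ x y : L.ConnectedComponent, componentAdj G L x y ∧ componentColors χ x ∈ U ∧
        componentColors χ y ∉ U := by
    rintro U ⟨x, hx⟩ ⟨y, hy⟩
    by_contra hn
    push Not at hn
    induction x using SimpleGraph.ConnectedComponent.ind with | h u => ?_
    induction y using SimpleGraph.ConnectedComponent.ind with | h v => ?_
    have := hconn {u | componentColors χ (L.connectedComponentMk u) ∈ U} ⟨u, hx⟩
      (fun a b hab ha => by
        rw [Set.mem_ofPred_eq, ← componentColors_eq hχ hL.inv hab]; exact ha)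
      (fun a b hab ha => hn _ _ ⟨a, b, rfl, rfl, hab⟩ ha)
    exact hy (Set.eq_univ_iff_forall.1 this v)
  obtain ⟨H, r, hr, hd, hc⟩ := exists_three_connected_of_homogeneous hI hsymm h3 h2 h1
  choose r' hr' using fun i => (r i).exists_rep
  refine ⟨fun i => L.connectedComponentMk ⁻¹' H i, r', fun i => ?_,
    fun i j x hi hj => hd i j _ hi hj, fun i x => ?_⟩
  · refine RootedIn.preimage_components hL.le ?_
    have := hr i
    rwa [← hr' i] at this
  · obtain ⟨y, hy, hyx⟩ := hc i (L.connectedComponentMk x)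
    have := mem_componentColors χ L x
    rw [← hyx] at this
    obtain ⟨u, rfl, hu⟩ := this
    exact ⟨u, hy, hu⟩

end stable

theorem RootedIn.induce_connected {V : Type*} {G : SimpleGraph V} {W S : Set V} {r : W}
    {T : Set W} (hT : RootedIn (G.induce W).Adj T r) (hS : S = Subtype.val '' T) :
    (G.induce S).Connected := by
  subst hS
  have hr : (r : V) ∈ Subtype.val '' T := ⟨r, hT.1, rfl⟩
  have key : ∀ x, Relation.ReflTransGen (fun a b => (G.induce W).Adj a b ∧ a ∈ T ∧ b ∈ T) r x →
      ∀ hx : (x : V) ∈ Subtype.val '' T,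
      (G.induce (Subtype.val '' T)).Reachable ⟨r, hr⟩ ⟨x, hx⟩ := by
    intro x hx
    induction hx with
    | refl => exact fun _ => SimpleGraph.Reachable.refl _
    | @tail y z _ hz ih =>
      intro hz'
      refine (ih ⟨y, hz.2.1, rfl⟩).trans (SimpleGraph.Adj.reachable ?_)
      exact hz.1
  have : Nonempty (Subtype.val '' T : Set V) := ⟨⟨r, hr⟩⟩
  refine SimpleGraph.Connected.mk fun a b => ?_
  have hall : ∀ a, (G.induce (Subtype.val '' T)).Reachable ⟨r, hr⟩ a := by
    rintro ⟨_, x, hx, rfl⟩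
    exact key x (hT.2 x hx) ⟨x, hx, rfl⟩
  exact (hall a).symm.trans (hall b)

theorem IsTwoStable.isTriangleStable {V C : Type*} [Finite V] {G : SimpleGraph V} {χ : V → V → C}
    (hχ : IsTwoStable G χ) : IsTriangleStable G χ := by
  intro u v u' v' h
  obtain ⟨h1, h2, h3⟩ := hχ u v u' v' h
  refine ⟨h1, h2, fun w => ?_⟩
  have hpos : 0 < {x : V | χ u x = χ u w ∧ χ x v = χ w v}.ncard :=
    (Set.ncard_pos (Set.toFinite _)).2 ⟨w, rfl, rfl⟩
  rw [h3] at hpos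
  obtain ⟨w', h, h'⟩ := (Set.ncard_pos (Set.toFinite _)).1 hpos
  exact ⟨w', h.symm, h'.symm⟩

/-- Restriction to a union of vertex color classes. -/
theorem IsTriangleStable.induce {V C : Type*} {G : SimpleGraph V} {χ : V → V → C}
    (hχ : IsTriangleStable G χ) {W : Set V} (hW : ∀ u v, χ u u = χ v v → u ∈ W → v ∈ W) :
    IsTriangleStable (G.induce W) (fun u v : W => χ u v) := by
  intro u v u' v' h
  obtain ⟨h1, h2, h3⟩ := hχ _ _ _ _ h
  refine ⟨by simpa only [Subtype.ext_iff] using h1, h2, fun w => ?_⟩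
  obtain ⟨w', hw, hw'⟩ := h3 w
  exact ⟨⟨w', hW _ _ (hχ.right hw) w.2⟩, hw, hw'⟩

theorem stmt0 {V C : Type*} [Fintype V] (G : SimpleGraph V) (h : ℕ) (hh : 1 ≤ h)
    (hminor : ¬ HasK3hMinor G h) (χ : V → V → C) (hχ : IsTwoStable G χ)
    (D : Set V) (hD : D = {v : V | {w : V | χ w w = χ v v}.ncard = 1})
    (hbig : ∀ w : V, w ∉ D → 3 ≤ {x : V | χ x x = χ w w}.ncard)
    (Z : Set V) (hZsub : Z ⊆ Dᶜ) (hZconn : (G.induce Z).Connected)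
    (hZclosed : ∀ u ∈ Z, ∀ w : V, w ∉ D → G.Adj u w → w ∈ Z) :
    {x : V | x ∉ Z ∧ ∃ z ∈ Z, G.Adj x z}.ncard < h := by
  classical
  by_contra hlt
  rw [not_lt] at hlt
  apply hminor
  have hst := hχ.isTriangleStable
  have hDsub : ∀ x, x ∈ D → ∀ y, χ y y = χ x x → y = x := by
    intro x hx y hy
    rw [hD] at hx
    obtain ⟨a, ha⟩ := Set.ncard_eq_one.1 hx
    have h1 : y ∈ ({a} : Set V) := ha ▸ hy
    have h2 : x ∈ ({a} : Set V) := ha ▸ (rfl : χ x x = χ x x)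
    rw [h1, h2]
  set W : Set V := {v | ∃ z ∈ Z, χ z z = χ v v} with hWdef
  have hWcol : ∀ u v, χ u u = χ v v → u ∈ W → v ∈ W :=
    fun u v huv ⟨z, hz, hzu⟩ => ⟨z, hz, hzu.trans huv⟩
  have hZW : Z ⊆ W := fun z hz => ⟨z, hz, rfl⟩
  have hWD : ∀ x, x ∈ W → x ∉ D := by
    rintro x ⟨z, hz, hzx⟩ hx
    have := hDsub x hx z hzx
    exact hZsub hz (this ▸ hx)
  obtain ⟨⟨z₀, hz₀⟩⟩ := hZconn.nonempty
  have : Nonempty W := ⟨⟨z₀, hZW hz₀⟩⟩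
  have hthree : ∀ v : W, ∃ f : Fin 3 → W, Function.Injective f ∧ ∀ i, χ (f i) (f i) = χ v v := by
    rintro ⟨v, hv⟩
    obtain ⟨s, hs, hsc⟩ := Set.exists_subset_card_eq (hbig v (hWD v hv))
    have hsc' : Nat.card s = 3 := hsc
    let e : Fin 3 ≃ s := (Finite.equivFinOfCardEq hsc').symm
    refine ⟨fun i => ⟨e i, hWcol v _ (hs (e i).2).symm hv⟩, fun i j hij => ?_,
      fun i => hs (e i).2⟩
    exact e.injective (Subtype.ext (congrArg (fun x : W => (x : V)) hij))
  have hconn : ∀ S : Set W, S.Nonempty → (∀ u v : W, χ u u = χ v v → u ∈ S → v ∈ S) →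
      (∀ u v : W, (G.induce W).Adj u v → u ∈ S → v ∈ S) → S = Set.univ := by
    rintro S ⟨⟨u, hu⟩, huS⟩ hScol hSadj
    obtain ⟨z, hz, hzu⟩ := id hu
    have hzS : (⟨z, hZW hz⟩ : W) ∈ S := hScol ⟨u, hu⟩ _ hzu.symm huS
    have hZS : ∀ a : Z, (⟨a, hZW a.2⟩ : W) ∈ S := by
      intro a
      obtain ⟨p⟩ := (hZconn.preconnected ⟨z, hz⟩ a).symm
      have : ∀ a b : Z, (G.induce Z).Walk a b → (⟨b, hZW b.2⟩ : W) ∈ S →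
          (⟨a, hZW a.2⟩ : W) ∈ S := by
        intro a b p
        induction p with
        | nil => exact id
        | cons hadj p ih => exact fun hb => hSadj ⟨_, _⟩ ⟨_, _⟩ (show G.Adj _ _ from hadj.symm) (ih hb)
      exact this _ _ p hzS
    rw [Set.eq_univ_iff_forall]
    rintro ⟨x, hx⟩
    obtain ⟨z', hz', hzx⟩ := id hx
    exact hScol ⟨z', hZW hz'⟩ _ hzx (hZS ⟨z', hz'⟩)
  obtain ⟨H, r, hr, hd, hc⟩ := exists_three_connected_of_stable (hst.induce hWcol) hthree hconn
  obtain ⟨s, hs, hsc⟩ := Set.exists_subset_card_eq hlt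
  have hsc' : Nat.card s = h := hsc
  let e : Fin h ≃ s := (Finite.equivFinOfCardEq hsc').symm
  have hsD : ∀ j, (e j : V) ∈ D := by
    intro j
    obtain ⟨hx, z, hz, hxz⟩ := hs (e j).2
    by_contra hn
    exact hx (hZclosed z hz _ hn hxz.symm)
  refine ⟨fun i => Subtype.val '' H i, fun j => {(e j : V)}, fun i => ⟨r i, r i, (hr i).1, rfl⟩,
    fun j => ⟨_, rfl⟩, fun i => (hr i).induce_connected rfl, fun j => ?_, ?_, ?_, ?_, ?_⟩
  · have : Nonempty ({(e j : V)} : Set V) := ⟨⟨_, rfl⟩⟩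
    refine SimpleGraph.Connected.mk fun a b => ?_
    rw [Subsingleton.elim a b]
  · intro i j hij
    rw [Set.disjoint_left]
    rintro _ ⟨x, hx, rfl⟩ ⟨y, hy, hyx⟩
    rw [Subtype.ext hyx] at hy
    exact hij (hd i j x hx hy)
  · intro j j' hjj
    rw [Set.disjoint_singleton]
    exact fun h => hjj (e.injective (Subtype.ext h))
  · intro i j
    rw [Set.disjoint_singleton_right]
    rintro ⟨x, hx, hxe⟩
    exact hWD x x.2 (hxe ▸ hsD j)
  · intro i j
    obtain ⟨-, z, hz, hxz⟩ := hs (e j).2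
    obtain ⟨y, hy, hyz⟩ := hc i ⟨z, hZW hz⟩
    obtain ⟨w, hw⟩ := hst.exists_pair (u := z) (u' := y) hyz.symm (e j)
    have hwe : w = e j := hDsub _ (hsD j) _ (hst.right hw).symm
    subst hwe
    exact ⟨y, ⟨y, hy, rfl⟩, _, rfl, (hst _ _ _ _ hw).2.1.1 hxz.symm⟩
end

section
/- Let h ≥ 1 and let G be a finite simple graph that has no K_{3,h} minor. Let χ be a 1-stable coloring of G, let D := {v ∈ V(G) : |[v]_χ| = 1}, and assume that |[w]_χ| ≥ h for every w ∈ V(G) \ D. Then for every connected component Z of G − D it holds that |N_G(Z)| < 3. (This is Lemma 'find-small-color-class' of the paper in the explicit-coloring form used in its proof.) -/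
/-- A vertex coloring is 1-stable for `G`: equally colored vertices have, for every
color `a`, the same number of neighbors of color `a`. -/
def IsOneStable {V C : Type*} (G : SimpleGraph V) (χ : V → C) : Prop :=
  ∀ u v : V, χ u = χ v →
    ∀ a : C, {w : V | G.Adj u w ∧ χ w = a}.ncard = {w : V | G.Adj v w ∧ χ w = a}.ncard

open Set

/-- A set with at least `n` elements contains the values of an injective `n`-tuple. -/
lemma exists_injective_fin_of_le_ncard {V : Type*} [Finite V] {n : ℕ} {s : Set V}
    (hn : n ≤ s.ncard) : ∃ f : Fin n → V, Function.Injective f ∧ ∀ i, f i ∈ s := by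
  classical
  have := Fintype.ofFinite V
  rw [Set.ncard_eq_toFinset_card'] at hn
  obtain ⟨t, hts, ht⟩ := Finset.exists_subset_card_eq hn
  refine ⟨fun i => (t.equivFinOfCardEq ht).symm i, ?_, fun i => ?_⟩
  · exact Subtype.val_injective.comp (Equiv.injective _)
  · exact Set.mem_toFinset.1 (hts ((t.equivFinOfCardEq ht).symm i).2)

namespace SimpleGraph

/-- A walk ending in `S` contains a walk that meets `S` only in its last vertex. -/
lemma Walk.exists_walk_to_first_mem {Q : Type*} {H : SimpleGraph Q} (S : Set Q) {a b : Q}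
    (w : H.Walk a b) (hb : b ∈ S) :
    ∃ m ∈ S, ∃ q : H.Walk a m, ∀ s ∈ q.support, s ∈ S → s = m := by
  induction w with
  | nil => exact ⟨_, hb, Walk.nil, by simp⟩
  | @cons a c b hac p ih =>
    by_cases ha : a ∈ S
    · exact ⟨a, ha, Walk.nil, by simp⟩
    · obtain ⟨m, hm, q, hq⟩ := ih hb
      refine ⟨m, hm, Walk.cons hac q, fun s hs hsS => ?_⟩
      rw [Walk.support_cons, List.mem_cons] at hs
      rcases hs with rfl | hs
      · exact absurd hsS ha
      · exact hq s hs hsS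

/-- Three mutually reachable vertices are the ends of three paths from a common vertex
that meet only there. -/
lemma exists_three_paths {Q : Type*} (H : SimpleGraph Q) (u : Fin 3 → Q)
    (hu : ∀ i j, H.Reachable (u i) (u j)) :
    ∃ (m : Q) (p : ∀ i, H.Walk m (u i)), (∀ i, (p i).IsPath) ∧
      ∀ i j, i ≠ j → ∀ s ∈ (p i).support, s ∈ (p j).support → s = m := by
  classical
  obtain ⟨p, hp⟩ := (hu 0 1).exists_isPath
  obtain ⟨w⟩ := hu 2 0
  obtain ⟨m, hm, q, hq⟩ := w.exists_walk_to_first_mem {s | s ∈ p.support} p.start_mem_support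
  have hm' : m ∈ p.support := hm
  have hq' : ∀ s ∈ q.reverse.bypass.support, s ∈ q.support := fun s hs => by
    simpa using Walk.support_bypass_subset_support _ hs
  have h01 : ∀ s ∈ (p.takeUntil m hm').support, s ∈ (p.dropUntil m hm').support → s = m := by
    intro s hs hs'
    have hnd := hp.support_nodup
    rw [← p.take_spec hm', Walk.support_append] at hnd
    by_contra hne
    rw [← Walk.cons_tail_support, List.mem_cons] at hs'
    exact (List.nodup_append.1 hnd).2.2 s hs s (hs'.resolve_left hne) rfl
  have h02 : ∀ s ∈ (p.takeUntil m hm').support, s ∈ q.support → s = m := fun s hs hs' =>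
    hq s hs' (p.support_takeUntil_subset_support hm' hs)
  have h12 : ∀ s ∈ (p.dropUntil m hm').support, s ∈ q.support → s = m := fun s hs hs' =>
    hq s hs' (p.support_dropUntil_subset_support hm' hs)
  refine ⟨m, fun i => match i with
    | 0 => (p.takeUntil m hm').reverse
    | 1 => p.dropUntil m hm'
    | 2 => q.reverse.bypass, ?_, ?_⟩
  · intro i
    fin_cases i
    · exact (hp.takeUntil hm').reverse
    · exact hp.dropUntil hm'
    · exact Walk.bypass_isPath _
  · intro i j hij s hi hj
    fin_cases i <;> fin_cases j <;> simp only [Walk.support_reverse, List.mem_reverse] at hi hj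
    · exact absurd rfl hij
    · exact h01 s hi hj
    · exact h02 s hi (hq' s hj)
    · exact h01 s hj hi
    · exact absurd rfl hij
    · exact h12 s hi (hq' s hj)
    · exact h02 s hj (hq' s hi)
    · exact h12 s hj (hq' s hi)
    · exact absurd rfl hij

/-- Adding vertices that have a neighbor in a connected set keeps the set connected. -/
lemma induce_union_connected_of_forall_exists_adj {V : Type*} {G : SimpleGraph V} {T T' : Set V}
    (hT : (G.induce T).Connected) (h : ∀ x ∈ T', ∃ y ∈ T, G.Adj y x) :
    (G.induce (T ∪ T')).Connected := by
  obtain ⟨⟨t, ht⟩⟩ := hT.nonempty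
  refine induce_connected_of_patches t (Or.inl ht) @fun x hx => ?_
  rcases hx with hx | hx
  · exact ⟨T, subset_union_left, ht, hx, hT.preconnected _ _⟩
  · obtain ⟨y, hy, hyx⟩ := h x hx
    have hc : (G.induce (T ∪ {y, x})).Connected :=
      induce_union_connected hT.preconnected
        (induce_pair_connected_of_adj hyx).preconnected ⟨y, hy, by simp⟩
    exact ⟨T ∪ {y, x}, union_subset subset_union_left (by
        rintro z (rfl | rfl)
        · exact Or.inl hy
        · exact Or.inr hx), Or.inl ht, Or.inr (by simp), hc.preconnected _ _⟩

/-- If adjacent colors of `H` force neighbors in `G` and every vertex of the last color of a path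
in `H` is adjacent to `v`, then `v` together with the color classes on the path beyond the first
one is connected and dominates the first one. -/
lemma Walk.IsPath.exists_connected_preimage {V C : Type*} {G : SimpleGraph V} {χ : V → C}
    {H : SimpleGraph C} (hH : ∀ a b, H.Adj a b → ∀ x, χ x = a → ∃ y, χ y = b ∧ G.Adj y x)
    {v : V} {a u : C} {p : H.Walk a u} (hp : p.IsPath) (hv : ∀ x, χ x = u → G.Adj v x) :
    ∃ S : Set C, (∀ s ∈ S, s ∈ p.support ∧ s ≠ a) ∧ (G.induce ({v} ∪ χ ⁻¹' S)).Connected ∧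
      ∀ x, χ x = a → ∃ b ∈ {v} ∪ χ ⁻¹' S, G.Adj b x := by
  induction p with
  | nil =>
    refine ⟨∅, by simp, ?_, fun x hx => ⟨v, by simp, hv x hx⟩⟩
    rw [preimage_empty, union_empty]
    exact Connected.of_subsingleton
  | @cons a b u hab p ih =>
    rw [Walk.cons_isPath_iff] at hp
    obtain ⟨S, hS, hconn, hdom⟩ := ih hp.1 hv
    refine ⟨S ∪ {b}, ?_, ?_, fun x hx => ?_⟩
    · have key : ∀ s ∈ p.support, s ∈ (Walk.cons hab p).support ∧ s ≠ a := fun s hs =>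
        ⟨by simp [hs], fun h => hp.2 (h ▸ hs)⟩
      rintro s (hs | rfl)
      · exact key s (hS s hs).1
      · exact key s p.start_mem_support
    · rw [preimage_union, ← union_assoc]
      exact induce_union_connected_of_forall_exists_adj hconn hdom
    · obtain ⟨y, hy, hyx⟩ := hH a b hab x hx
      exact ⟨y, Or.inr (Or.inr hy), hyx⟩

end SimpleGraph

/-- In a 1-stable coloring, adjacency of two colors at one vertex passes to the whole class. -/
lemma IsOneStable.exists_adj {V C : Type*} [Finite V] {G : SimpleGraph V} {χ : V → C}
    (hχ : IsOneStable G χ) {u v w : V} (hw : G.Adj u w) (huv : χ u = χ v) :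
    ∃ y, G.Adj v y ∧ χ y = χ w := by
  have h := hχ u v huv (χ w)
  have hpos : 0 < {y : V | G.Adj u y ∧ χ y = χ w}.ncard :=
    (Set.ncard_pos).2 ⟨w, hw, rfl⟩
  rw [h] at hpos
  exact (Set.ncard_pos).1 hpos

theorem stmt1 {V C : Type*} [Fintype V] (G : SimpleGraph V) (h : ℕ) (hh : 1 ≤ h)
    (hminor : ¬ HasK3hMinor G h) (χ : V → C) (hχ : IsOneStable G χ)
    (D : Set V) (hD : D = {v : V | {w : V | χ w = χ v}.ncard = 1})
    (hbig : ∀ w : V, w ∉ D → h ≤ {x : V | χ x = χ w}.ncard)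
    (Z : Set V) (hZsub : Z ⊆ Dᶜ) (hZconn : (G.induce Z).Connected)
    (hZclosed : ∀ u ∈ Z, ∀ w : V, w ∉ D → G.Adj u w → w ∈ Z) :
    {x : V | x ∉ Z ∧ ∃ z ∈ Z, G.Adj x z}.ncard < 3 := by
  classical
  by_contra hcard
  obtain ⟨v, hvinj, hv⟩ := exists_injective_fin_of_le_ncard (not_lt.1 hcard)
  choose hvZ z hzZ hvz using hv
  have hDcol : ∀ x y, χ x = χ y → x ∈ D → y ∈ D := by
    intro x y hxy hx
    rw [hD, Set.mem_ofPred_eq] at hx ⊢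
    rwa [← hxy]
  have hDsingle : ∀ x ∈ D, ∀ y, χ y = χ x → y = x := by
    intro x hx y hy
    rw [hD, Set.mem_ofPred_eq, Set.ncard_eq_one] at hx
    obtain ⟨t, ht⟩ := hx
    have hxt : x ∈ ({t} : Set V) := ht ▸ rfl
    have hyt : y ∈ ({t} : Set V) := ht ▸ hy
    rw [Set.mem_singleton_iff.1 hyt, Set.mem_singleton_iff.1 hxt]
  have hvD : ∀ i, v i ∈ D := fun i => by
    by_contra hn
    exact hvZ i (hZclosed _ (hzZ i) _ hn (hvz i).symm)
  let H : SimpleGraph C :=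
    SimpleGraph.fromRel fun a b => ∃ x ∈ Z, ∃ y ∈ Z, χ x = a ∧ χ y = b ∧ G.Adj x y
  have hHadj : ∀ a b, H.Adj a b → ∃ x ∈ Z, ∃ y ∈ Z, χ x = a ∧ χ y = b ∧ G.Adj x y := by
    intro a b hab
    rcases ((SimpleGraph.fromRel_adj _ _ _).1 hab).2 with h | ⟨x, hx, y, hy, hxa, hyb, hxy⟩
    · exact h
    · exact ⟨y, hy, x, hx, hyb, hxa, hxy.symm⟩
  have hHG : ∀ a b, H.Adj a b → ∀ x, χ x = a → ∃ y, χ y = b ∧ G.Adj y x := by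
    intro a b hab x hx
    obtain ⟨x', -, y', -, hx', hy', hadj⟩ := hHadj a b hab
    obtain ⟨y, hy, hyc⟩ := hχ.exists_adj hadj (hx'.trans hx.symm)
    exact ⟨y, hyc.trans hy', hy.symm⟩
  have hreach : ∀ x y : Z, H.Reachable (χ x) (χ y) := by
    intro x y
    obtain ⟨w⟩ := hZconn.preconnected x y
    induction w with
    | nil => exact SimpleGraph.Reachable.refl _
    | @cons x y t hxy p ih =>
      refine SimpleGraph.Reachable.trans ?_ ih
      by_cases hc : χ x = χ y
      · rw [hc]
      · exact SimpleGraph.Adj.reachable ((SimpleGraph.fromRel_adj _ _ _).2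
          ⟨hc, Or.inl ⟨x, x.2, y, y.2, rfl, rfl, hxy⟩⟩)
  have hcolZ : ∀ a b : C, H.Reachable b a → (∃ x ∈ Z, χ x = a) → ∃ x ∈ Z, χ x = b := by
    rintro a b ⟨w⟩ ha
    cases w with
    | nil => exact ha
    | cons hab p =>
      obtain ⟨x, hx, -, -, hxa, -⟩ := hHadj _ _ hab
      exact ⟨x, hx, hxa⟩
  obtain ⟨m, p, hp, hdisj⟩ := H.exists_three_paths (fun i => χ (z i))
    fun i j => hreach ⟨z i, hzZ i⟩ ⟨z j, hzZ j⟩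
  have hvadj : ∀ i x, χ x = χ (z i) → G.Adj (v i) x := by
    intro i x hx
    obtain ⟨y, hy, hyc⟩ := hχ.exists_adj (hvz i).symm hx.symm
    rw [← hDsingle _ (hvD i) y hyc]
    exact hy.symm
  choose S hS hconn hdom using fun i => (hp i).exists_connected_preimage hHG (hvadj i)
  have hcolD : ∀ i, ∀ x, χ x ∈ (p i).support → x ∉ D := by
    intro i x hx hxD
    obtain ⟨y, hy, hyx⟩ := hcolZ _ _ ⟨(p i).dropUntil _ hx⟩ ⟨z i, hzZ i, rfl⟩
    exact hZsub hy (hDcol x y hyx.symm hxD)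
  obtain ⟨w, hwZ, rfl⟩ := hcolZ _ _ ⟨p 0⟩ ⟨z 0, hzZ 0, rfl⟩
  obtain ⟨f, hfinj, hf⟩ := exists_injective_fin_of_le_ncard (hbig w (hZsub hwZ))
  refine hminor ⟨fun i => {v i} ∪ χ ⁻¹' S i, fun j => {f j}, fun i => ⟨v i, by simp⟩,
    fun j => Set.singleton_nonempty _, hconn, fun j => SimpleGraph.Connected.of_subsingleton,
    fun i j hij => ?_, fun i j hij => ?_, fun i j => ?_, fun i j => ?_⟩
  · rw [Set.disjoint_left]
    rintro x (rfl | hx) (hx' | hx')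
    · exact hij (hvinj hx')
    · exact hcolD j _ (hS j _ hx').1 (hvD i)
    · rw [Set.mem_singleton_iff] at hx'
      exact hcolD i _ (hS i _ hx).1 (hx' ▸ hvD j)
    · exact (hS i _ hx).2 (hdisj i j hij _ (hS i _ hx).1 (hS j _ hx').1)
  · exact Set.disjoint_singleton.2 fun h => hij (hfinj h)
  · rw [Set.disjoint_singleton_right]
    rintro (hx | hx)
    · exact hZsub hwZ (hDcol (f j) w (hf j) (Set.mem_singleton_iff.1 hx ▸ hvD i))
    · exact (hS i _ hx).2 (hf j)
  · obtain ⟨b, hb, hadj⟩ := hdom i (f j) (hf j)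
    exact ⟨b, hb, f j, rfl, hadj⟩
end

section
/- Let G be a finite simple graph, χ a 2-stable coloring of G, and c a vertex color of χ. Let P and Q be two χ-definable partitions of V_c with |P| ≤ |Q|, and let P_1, …, P_ℓ be distinct blocks of P. Then there exist vertices v_i ∈ P_i (for i = 1, …, ℓ) such that for all distinct i, j the vertices v_i and v_j lie in different blocks of Q. -/
/-- `P` is a χ-definable partition of the set `Vc`: a partition of `Vc` such that
membership of two distinct vertices of `Vc` in a common block is determined by the
χ-color of the pair, via some set of colors `CP`. -/
def IsChiDefinablePartition {V C : Type*} (χ : V → V → C) (Vc : Set V)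
    (P : Set (Set V)) : Prop :=
  (∀ p ∈ P, p.Nonempty) ∧ (∀ p ∈ P, p ⊆ Vc) ∧
  (∀ v ∈ Vc, ∃! p, p ∈ P ∧ v ∈ p) ∧
  ∃ CP : Set C, ∀ v ∈ Vc, ∀ w ∈ Vc, v ≠ w →
    ((∃ p ∈ P, v ∈ p ∧ w ∈ p) ↔ χ v w ∈ CP)

namespace IsTwoStable

variable {V C : Type*} {G : SimpleGraph V} {χ : V → V → C}

theorem diag_eq [Finite V] (hχ : IsTwoStable G χ) {u v u' v' : V} (h : χ u v = χ u' v') :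
    χ v v = χ v' v' := by
  have hcard := (hχ u v u' v' h).2.2 (χ u v) (χ v v)
  have hpos : 0 < {w : V | χ u w = χ u v ∧ χ w v = χ v v}.ncard :=
    (Set.ncard_pos (Set.toFinite _)).2 ⟨v, rfl, rfl⟩
  rw [hcard] at hpos
  obtain ⟨x, -, hx⟩ := (Set.ncard_pos (Set.toFinite _)).1 hpos
  obtain rfl : x = v' := (hχ _ _ _ _ hx).1.2 rfl
  exact hx.symm

theorem exists_equiv [Finite V] (hχ : IsTwoStable G χ) {v v' : V} (h : χ v v = χ v' v') :
    ∃ e : V ≃ V, ∀ w, χ v' (e w) = χ v w := by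
  have hfib (x : C × C) :
      Nat.card {w // (χ v w, χ w v) = x} = Nat.card {w // (χ v' w, χ w v') = x} := by
    simp only [Prod.ext_iff]
    exact (hχ _ _ _ _ h).2.2 x.1 x.2
  let e (x : C × C) := (Finite.card_eq.1 (hfib x)).some
  refine ⟨(Equiv.sigmaFiberEquiv fun w => (χ v w, χ w v)).symm.trans
    ((Equiv.sigmaCongrRight e).trans (Equiv.sigmaFiberEquiv fun w => (χ v' w, χ w v'))),
    fun w => ?_⟩
  exact congrArg Prod.fst (e _ ⟨w, rfl⟩).2

end IsTwoStable

namespace IsChiDefinablePartition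

variable {V C : Type*} {G : SimpleGraph V} {χ : V → V → C} {Vc : Set V} {c : C} {P : Set (Set V)}

theorem eq_of_mem (hP : IsChiDefinablePartition χ Vc P) {p q : Set V} {v : V}
    (hp : p ∈ P) (hq : q ∈ P) (hvp : v ∈ p) (hvq : v ∈ q) : p = q :=
  (hP.2.2.1 v (hP.2.1 p hp hvp)).unique ⟨hp, hvp⟩ ⟨hq, hvq⟩

theorem ncard_block_le [Finite V] (hχ : IsTwoStable G χ)
    (hP : IsChiDefinablePartition χ {v | χ v v = c} P) {p q : Set V} (hp : p ∈ P) (hq : q ∈ P) :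
    p.ncard ≤ q.ncard := by
  obtain ⟨v, hv⟩ := hP.1 p hp
  obtain ⟨v', hv'⟩ := hP.1 q hq
  have hvc : χ v v = c := hP.2.1 p hp hv
  have hvc' : χ v' v' = c := hP.2.1 q hq hv'
  obtain ⟨e, he⟩ := hχ.exists_equiv (hvc.trans hvc'.symm)
  obtain ⟨CP, hCP⟩ := hP.2.2.2
  refine Set.ncard_le_ncard_of_injOn e (fun w hw => ?_) e.injective.injOn (Set.toFinite _)
  have hwc : χ w w = c := hP.2.1 p hp hw
  have hec : χ (e w) (e w) = c := (hχ.diag_eq (he w)).trans hwc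
  by_cases hvw : v = w
  · rwa [← (hχ _ _ _ _ (he w)).1.2 hvw]
  · have hne : v' ≠ e w := fun h => hvw ((hχ _ _ _ _ (he w)).1.1 h)
    obtain ⟨r, hr, hvr, hwr⟩ := (hCP v' hvc' (e w) hec hne).2
      (he w ▸ (hCP v hvc w hwc hvw).1 ⟨p, hp, hv, hw⟩)
    rwa [hP.eq_of_mem hq hr hv' hvr]

theorem ncard_biUnion [Finite V] (hχ : IsTwoStable G χ)
    (hP : IsChiDefinablePartition χ {v | χ v v = c} P) {p : Set V} (hp : p ∈ P)
    (S : Finset (Set V)) (hS : ∀ q ∈ S, q ∈ P) :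
    (⋃ q ∈ S, q).ncard = S.card * p.ncard := by
  classical
  induction S using Finset.induction_on with
  | empty => simp
  | insert q S hq ih =>
    have hdisj : Disjoint q (⋃ r ∈ S, r) := by
      simp only [Set.disjoint_iUnion_right]
      refine fun r hr => Set.disjoint_left.2 fun v hvq hvr => hq ?_
      rwa [hP.eq_of_mem (hS q (by simp)) (hS r (by simp [hr])) hvq hvr]
    have hqp : q.ncard = p.ncard := le_antisymm
      (hP.ncard_block_le hχ (hS q (by simp)) hp) (hP.ncard_block_le hχ hp (hS q (by simp)))
    rw [Finset.set_biUnion_insert, Set.ncard_union_eq hdisj (Set.toFinite _) (Set.toFinite _),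
      ih fun r hr => hS r (by simp [hr]), Finset.card_insert_of_notMem hq, hqp]
    ring

theorem ncard_mul_ncard_block [Finite V] (hχ : IsTwoStable G χ)
    (hP : IsChiDefinablePartition χ {v | χ v v = c} P) {p : Set V} (hp : p ∈ P) :
    P.ncard * p.ncard = {v | χ v v = c}.ncard := by
  have hfin : P.Finite := Set.toFinite P
  rw [Set.ncard_eq_toFinset_card P hfin,
    ← hP.ncard_biUnion hχ hp hfin.toFinset fun q hq => hfin.mem_toFinset.1 hq]
  congr 1
  ext v
  simp only [Set.Finite.mem_toFinset, Set.mem_iUnion, exists_prop]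
  exact ⟨fun ⟨q, hq, hv⟩ => hP.2.1 q hq hv, fun hv => (hP.2.2.1 v hv).exists⟩

end IsChiDefinablePartition

theorem stmt3 {V C : Type*} [Fintype V] (G : SimpleGraph V) (χ : V → V → C)
    (hχ : IsTwoStable G χ) (c : C) (u₀ : V) (hc : χ u₀ u₀ = c)
    (P Q : Set (Set V))
    (hP : IsChiDefinablePartition χ {v : V | χ v v = c} P)
    (hQ : IsChiDefinablePartition χ {v : V | χ v v = c} Q)
    (hPQ : P.ncard ≤ Q.ncard)
    (ℓ : ℕ) (Pb : Fin ℓ → Set V) (hPb : ∀ i, Pb i ∈ P)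
    (hPbinj : Function.Injective Pb) :
    ∃ v : Fin ℓ → V, (∀ i, v i ∈ Pb i) ∧
      ∀ i j : Fin ℓ, i ≠ j → ∀ q ∈ Q, ¬ (v i ∈ q ∧ v j ∈ q) := by
  classical
  let t (i : Fin ℓ) : Finset (Set V) := (Set.toFinite {q | q ∈ Q ∧ (Pb i ∩ q).Nonempty}).toFinset
  have ht (i : Fin ℓ) (q : Set V) : q ∈ t i ↔ q ∈ Q ∧ (Pb i ∩ q).Nonempty := by simp [t]
  have hall (s : Finset (Fin ℓ)) : s.card ≤ (s.biUnion t).card := by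
    obtain ⟨p, ⟨hp, hup⟩, -⟩ := hP.2.2.1 u₀ hc
    obtain ⟨q, ⟨hq, huq⟩, -⟩ := hQ.2.2.1 u₀ hc
    have hppos : 0 < p.ncard := (Set.ncard_pos (Set.toFinite _)).2 ⟨u₀, hup⟩
    have hPpos : 0 < P.ncard := (Set.ncard_pos (Set.toFinite _)).2 ⟨p, hp⟩
    have hqp : q.ncard ≤ p.ncard := by
      refine Nat.le_of_mul_le_mul_left ?_ hPpos
      rw [hP.ncard_mul_ncard_block hχ hp, ← hQ.ncard_mul_ncard_block hχ hq]
      exact Nat.mul_le_mul_right _ hPQ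
    have hsub : (⋃ r ∈ s.image Pb, r) ⊆ ⋃ r ∈ s.biUnion t, r := by
      intro v hv
      simp only [Finset.mem_image, Set.mem_iUnion, exists_prop] at hv
      obtain ⟨_, ⟨i, hi, rfl⟩, hv⟩ := hv
      obtain ⟨r, hr, hvr⟩ := (hQ.2.2.1 v (hP.2.1 _ (hPb i) hv)).exists
      simp only [Set.mem_iUnion, exists_prop]
      exact ⟨r, Finset.mem_biUnion.2 ⟨i, hi, (ht i r).2 ⟨hr, v, hv, hvr⟩⟩, hvr⟩
    have hcard := Set.ncard_le_ncard hsub (Set.toFinite _)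
    rw [hP.ncard_biUnion hχ hp _ (by simpa using fun i _ => hPb i),
      hQ.ncard_biUnion hχ hq _ fun r hr => by
        obtain ⟨i, -, hi⟩ := Finset.mem_biUnion.1 hr
        exact ((ht i r).1 hi).1,
      Finset.card_image_of_injective _ hPbinj] at hcard
    exact Nat.le_of_mul_le_mul_right (hcard.trans (Nat.mul_le_mul_left _ hqp)) hppos
  obtain ⟨f, hf, hft⟩ := (Finset.all_card_le_biUnion_card_iff_exists_injective t).1 hall
  choose hfQ v hv using fun i => (ht i _).1 (hft i)
  refine ⟨v, fun i => (hv i).1, fun i j hij q hq ⟨hi, hj⟩ => hij (hf ?_)⟩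
  rw [hQ.eq_of_mem (hfQ i) hq (hv i).2 hi, hQ.eq_of_mem (hfQ j) hq (hv j).2 hj]
end

section
/- Let B be a finite bipartite graph with parts A = {v_1, v_2, v_3} (three distinct vertices) and W, such that |N_B(U)| ≥ |U| for every U ⊆ A. Let {P_1, P_2} be a partition of W such that N_B(v) ∩ P_1 ≠ ∅ and N_B(v) ∩ P_2 ≠ ∅ for every v ∈ A. Then there exist distinct vertices w_1, w_2, w_3 ∈ W such that v_r w_r ∈ E(B) for all r ∈ {1,2,3} and moreover |{w_1,w_2,w_3} ∩ P_1| ≤ 2 and |{w_1,w_2,w_3} ∩ P_2| ≤ 2. (This is the 'expansion' claim in the proof of the disjoint-subtrees lemma.) -/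
/-- A triple with an entry outside `P` meets `P` in at most two elements. -/
lemma ncard_triple_inter_le_two {V : Type*} (w : Fin 3 → V) (P : Set V)
    (h : ∃ r, w r ∉ P) : (({w 0, w 1, w 2} : Set V) ∩ P).ncard ≤ 2 := by
  obtain ⟨r, hr⟩ := h
  have pair_bound (a b : V) (hab : ({w 0, w 1, w 2} : Set V) ∩ P ⊆ {a, b}) :
      (({w 0, w 1, w 2} : Set V) ∩ P).ncard ≤ 2 :=
    (Set.ncard_le_ncard hab (Set.toFinite _)).trans
    (by simpa using Set.ncard_insert_le a {b})
  fin_cases r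
  · refine pair_bound (w 1) (w 2) ?_
    rintro x ⟨rfl | rfl | rfl, hx⟩ <;> simp_all
  · refine pair_bound (w 0) (w 2) ?_
    rintro x ⟨rfl | rfl | rfl, hx⟩ <;> simp_all
  · refine pair_bound (w 0) (w 1) ?_
    rintro x ⟨rfl | rfl | rfl, hx⟩ <;> simp_all

/-- A system of distinct representatives lying inside `P` can be modified in one place so that
it is contained neither in `P` nor in `Q`. -/
lemma exists_injective_not_mem_of_forall_mem {V : Type*} {R : Fin 3 → V → Prop}
    {P Q : Set V} (hPQ : Disjoint P Q) {w : Fin 3 → V} (hw : Function.Injective w)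
    (hR : ∀ r, R r (w r)) (hwP : ∀ r, w r ∈ P) (hQ : ∃ y ∈ Q, R 0 y) :
    ∃ w' : Fin 3 → V, Function.Injective w' ∧ (∀ r, R r (w' r)) ∧
      (∃ r, w' r ∉ P) ∧ ∃ r, w' r ∉ Q := by
  obtain ⟨y, hyQ, hy⟩ := hQ
  have hyP : y ∉ P := Set.disjoint_right.mp hPQ hyQ
  have hne (r : Fin 3) : w r ≠ y := fun h => hyP (h ▸ hwP r)
  refine ⟨Function.update w 0 y, ?_, ?_, ⟨0, by simpa using hyP⟩,
    ⟨1, by simpa using Set.disjoint_left.mp hPQ (hwP 1)⟩⟩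
  · intro a b hab
    by_cases ha : a = 0 <;> by_cases hb : b = 0
    · rw [ha, hb]
    · subst ha
      simp [Function.update_of_ne hb] at hab
      exact absurd hab.symm (hne b)
    · subst hb
      simp [Function.update_of_ne ha] at hab
      exact absurd hab (hne a)
    · rw [Function.update_of_ne ha, Function.update_of_ne hb] at hab
      exact hw hab
  · intro r
    by_cases hr : r = 0
    · subst hr
      simpa using hy
    · simpa [Function.update_of_ne hr] using hR r

theorem stmt5 {V : Type*} [Fintype V] (B : SimpleGraph V) (A W : Set V)
    (v : Fin 3 → V) (hvinj : Function.Injective v)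
    (hA : A = {v 0, v 1, v 2})
    (hAW : Disjoint A W)
    (hbip : ∀ x y : V, B.Adj x y → (x ∈ A ∧ y ∈ W) ∨ (x ∈ W ∧ y ∈ A))
    (hHall : ∀ U ⊆ A, U.ncard ≤ {w ∈ W | ∃ u ∈ U, B.Adj u w}.ncard)
    (P₁ P₂ : Set V) (hPunion : P₁ ∪ P₂ = W) (hPdisj : Disjoint P₁ P₂)
    (hP : ∀ u ∈ A, (∃ w ∈ P₁, B.Adj u w) ∧ (∃ w ∈ P₂, B.Adj u w)) :
    ∃ w : Fin 3 → V, Function.Injective w ∧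
      (∀ r, w r ∈ W ∧ B.Adj (v r) (w r)) ∧
      (({w 0, w 1, w 2} : Set V) ∩ P₁).ncard ≤ 2 ∧
      (({w 0, w 1, w 2} : Set V) ∩ P₂).ncard ≤ 2 := by
  classical
  have hvA (r : Fin 3) : v r ∈ A := by
    rw [hA]
    fin_cases r <;> simp
  have hadjW (r : Fin 3) (x : V) (h : B.Adj (v r) x) : x ∈ W := by
    rcases hbip _ _ h with h' | h'
    · exact h'.2
    · exact absurd h'.1 (Set.disjoint_left.mp hAW (hvA r))
  obtain ⟨w, hw, hwadj⟩ :=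
    (Finset.all_card_le_biUnion_card_iff_exists_injective
      (fun r : Fin 3 => Finset.univ.filter fun x => B.Adj (v r) x)).mp (by
        intro s
        have hs := hHall (v '' (s : Set (Fin 3))) (by
          rintro _ ⟨r, -, rfl⟩
          exact hvA r)
        rw [Set.ncard_image_of_injective _ hvinj, Set.ncard_coe_finset] at hs
        refine hs.trans ?_
        rw [← Set.ncard_coe_finset]
        refine Set.ncard_le_ncard ?_ (Set.toFinite _)
        rintro x ⟨-, _, ⟨r, hr, rfl⟩, hx⟩
        simpa using ⟨r, hr, hx⟩)
  simp only [Finset.mem_filter, Finset.mem_univ, true_and] at hwadj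
  obtain ⟨w', hw', hadj, h₁, h₂⟩ : ∃ w' : Fin 3 → V, Function.Injective w' ∧
      (∀ r, B.Adj (v r) (w' r)) ∧ (∃ r, w' r ∉ P₁) ∧ ∃ r, w' r ∉ P₂ := by
    by_cases h₁ : ∀ r, w r ∈ P₁
    · exact exists_injective_not_mem_of_forall_mem (R := fun r x => B.Adj (v r) x)
        hPdisj hw hwadj h₁ (hP _ (hvA 0)).2
    by_cases h₂ : ∀ r, w r ∈ P₂
    · obtain ⟨w', hw', hadj, hn₂, hn₁⟩ :=
        exists_injective_not_mem_of_forall_mem (R := fun r x => B.Adj (v r) x)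
          hPdisj.symm hw hwadj h₂ (hP _ (hvA 0)).1
      exact ⟨w', hw', hadj, hn₁, hn₂⟩
    · exact ⟨w, hw, hwadj, not_forall.mp h₁, not_forall.mp h₂⟩
  exact ⟨w', hw', fun r => ⟨hadjW r _ (hadj r), hadj r⟩,
    ncard_triple_inter_le_two w' P₁ h₁, ncard_triple_inter_le_two w' P₂ h₂⟩
end

section
/- Let G be a finite simple graph, χ a 2-stable coloring of G, and u, v ∈ V(G). Then the diagonal class of u is at most as large as the pair class of (u,v); that is, |{w ∈ V(G) : χ(w,w) = χ(u,u)}| ≤ |{(u',v') ∈ V(G) × V(G) : χ(u',v') = χ(u,v)}|. In particular, if some color class of χ on pairs has size at most t, then some diagonal class {w : χ(w,w) = χ(u,u)} has size at most t. -/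
/-- In a 2-stable coloring, if the diagonal pairs at `u` and `w` have the same color, then every
color of a pair starting at `u` is also the color of a pair starting at `w`. -/
theorem IsTwoStable.exists_color_eq {V C : Type*} [Finite V] {G : SimpleGraph V} {χ : V → V → C}
    (hχ : IsTwoStable G χ) {u w : V} (h : χ w w = χ u u) (v : V) :
    ∃ x : V, χ w x = χ u v := by
  have hcard := (hχ w w u u h).2.2 (χ u v) (χ v u)
  have hpos : 0 < {x : V | χ u x = χ u v ∧ χ x u = χ v u}.ncard :=
    (Set.ncard_pos (Set.toFinite _)).2 ⟨v, rfl, rfl⟩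
  rw [← hcard] at hpos
  obtain ⟨x, hx, -⟩ := (Set.ncard_pos (Set.toFinite _)).1 hpos
  exact ⟨x, hx⟩

/-- In a 2-stable coloring, a diagonal class is at most as large as the class of any pair
starting at one of its vertices. -/
theorem IsTwoStable.ncard_diagonal_le {V C : Type*} [Finite V] {G : SimpleGraph V}
    {χ : V → V → C} (hχ : IsTwoStable G χ) (u v : V) :
    {w : V | χ w w = χ u u}.ncard ≤ {p : V × V | χ p.1 p.2 = χ u v}.ncard := by
  have hsub : {w : V | χ w w = χ u u} ⊆ Prod.fst '' {p : V × V | χ p.1 p.2 = χ u v} := by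
    intro w hw
    obtain ⟨x, hx⟩ := hχ.exists_color_eq hw v
    exact ⟨(w, x), hx, rfl⟩
  exact (Set.ncard_le_ncard hsub (Set.toFinite _)).trans (Set.ncard_image_le (Set.toFinite _))

theorem stmt9 {V C : Type*} [Fintype V] (G : SimpleGraph V) (χ : V → V → C)
    (hχ : IsTwoStable G χ) :
    (∀ u v : V, {w : V | χ w w = χ u u}.ncard ≤
      {p : V × V | χ p.1 p.2 = χ u v}.ncard) ∧
    (∀ t : ℕ, ∀ a b : V, {p : V × V | χ p.1 p.2 = χ a b}.ncard ≤ t →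
      ∃ u : V, {w : V | χ w w = χ u u}.ncard ≤ t) := by
  exact ⟨hχ.ncard_diagonal_le, fun _ a b h => ⟨a, (hχ.ncard_diagonal_le a b).trans h⟩⟩
end

section
/- Let G be a finite simple graph, χ a 2-stable coloring of G, and v ∈ V(G) a vertex whose diagonal class is a singleton, i.e., {w ∈ V(G) : χ(w,w) = χ(v,v)} = {v}. Then for every vertex color c of χ, either V_c ⊆ N_G(v) or V_c ∩ N_G(v) = ∅; that is, v is adjacent to all vertices of the class V_c or to none of them. -/
namespace IsTwoStable

variable {V C : Type*} [Finite V] {G : SimpleGraph V} {χ : V → V → C}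

/-- Pairs of the same color have the same two-step color patterns. -/
theorem exists_of_eq (hχ : IsTwoStable G χ) {x y x' y' : V} (h : χ x y = χ x' y') (w : V) :
    ∃ w', χ x' w' = χ x w ∧ χ w' y' = χ w y := by
  have hcard := (hχ x y x' y' h).2.2 (χ x w) (χ w y)
  have hpos : 0 < {z : V | χ x z = χ x w ∧ χ z y = χ w y}.ncard :=
    (Set.ncard_pos (Set.toFinite _)).2 ⟨w, rfl, rfl⟩
  rw [hcard] at hpos
  exact (Set.ncard_pos (Set.toFinite _)).1 hpos

/-- The color of a pair determines the color of its second vertex. -/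
theorem diag_right_eq (hχ : IsTwoStable G χ) {x y x' y' : V} (h : χ x y = χ x' y') :
    χ y' y' = χ y y := by
  obtain ⟨z, -, hz⟩ := hχ.exists_of_eq h y
  obtain rfl : z = y' := (hχ z y' y y hz).1.2 rfl
  exact hz

end IsTwoStable

theorem stmt10 {V C : Type*} [Fintype V] (G : SimpleGraph V) (χ : V → V → C)
    (hχ : IsTwoStable G χ) (v : V)
    (hsing : {w : V | χ w w = χ v v} = {v})
    (c : C) (u : V) (hc : χ u u = c) :
    {x : V | χ x x = c} ⊆ G.neighborSet v ∨
    {x : V | χ x x = c} ∩ G.neighborSet v = ∅ := by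
  rw [← Set.disjoint_iff_inter_eq_empty, or_iff_not_imp_right, Set.not_disjoint_iff]
  rintro ⟨x, hx, hadj⟩ y hy
  obtain ⟨w, hw, -⟩ := hχ.exists_of_eq (Eq.trans hx (Eq.symm hy)) v
  obtain rfl : w = v := hsing.subset (hχ.diag_right_eq hw.symm)
  exact ((hχ y w x w hw).2.1.2 (G.adj_symm hadj)).symm
end

section
/- Let G be a finite simple graph, χ a 2-stable coloring of G, c a vertex color of χ, and P a χ-definable partition of V_c. Then all blocks of P have the same cardinality. -/
/-- Maps on a finite type with equally large fibers have equally large preimages. -/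
theorem ncard_preimage_eq_of_ncard_fiber_eq {V T : Type*} [Finite V] (f g : V → T)
    (h : ∀ t, {x | f x = t}.ncard = {x | g x = t}.ncard) (S : Set T) :
    (f ⁻¹' S).ncard = (g ⁻¹' S).ncard := by
  have e : ∀ t, Nonempty ({x // f x = t} ≃ {x // g x = t}) := fun t =>
    Finite.card_eq.1 (h t)
  let E : V ≃ V := Equiv.ofFiberEquiv fun t => (e t).some
  have hE : ∀ x, g (E x) = f x := Equiv.ofFiberEquiv_map fun t => (e t).some
  have hpre : f ⁻¹' S = E ⁻¹' (g ⁻¹' S) := by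
    ext x
    simp [hE]
  rw [hpre, ← Equiv.image_symm_eq_preimage]
  exact Set.ncard_image_of_injective _ E.symm.injective

/-- In a 2-stable coloring, the color of a pair determines the vertex color of its endpoint. -/
theorem IsTwoStable.color_endpoint_eq {V C : Type*} [Finite V] {G : SimpleGraph V}
    {χ : V → V → C} (hχ : IsTwoStable G χ) {u v u' v' : V} (h : χ u v = χ u' v') :
    χ v v = χ v' v' := by
  have hcard := (hχ u v u' v' h).2.2 (χ u v) (χ v v)
  have hpos : 0 < {w : V | χ u w = χ u v ∧ χ w v = χ v v}.ncard :=
    (Set.ncard_pos (Set.toFinite _)).2 ⟨v, rfl, rfl⟩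
  obtain ⟨w, -, hw⟩ := (Set.ncard_pos (Set.toFinite _)).1 (hcard ▸ hpos)
  have hwv : w = v' := (hχ w v' v v hw).1.2 rfl
  rw [← hw, hwv]

/-- In a 2-stable coloring, vertices of the same color have the same number of outgoing pairs
with color in a given set. -/
theorem IsTwoStable.ncard_color_mem_eq {V C : Type*} [Finite V] {G : SimpleGraph V}
    {χ : V → V → C} (hχ : IsTwoStable G χ) {v w : V} (h : χ v v = χ w w) (D : Set C) :
    {x | χ v x ∈ D}.ncard = {x | χ w x ∈ D}.ncard := by
  refine ncard_preimage_eq_of_ncard_fiber_eq (fun x => (χ v x, χ x v))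
    (fun x => (χ w x, χ x w)) (fun t => ?_) {t | t.1 ∈ D}
  simpa only [Prod.ext_iff] using (hχ v v w w h).2.2 t.1 t.2

theorem stmt11 {V C : Type*} [Fintype V] (G : SimpleGraph V) (χ : V → V → C)
    (hχ : IsTwoStable G χ) (c : C) (u₀ : V) (hc : χ u₀ u₀ = c)
    (P : Set (Set V))
    (hP : IsChiDefinablePartition χ {v : V | χ v v = c} P) :
    ∀ p ∈ P, ∀ q ∈ P, p.ncard = q.ncard := by
  obtain ⟨hne, hsub, huniq, CP, hCP⟩ := hP
  let D : Set C := {a | ∃ p ∈ P, ∃ u ∈ p, ∃ x ∈ p, χ u x = a}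
  have key : ∀ p ∈ P, ∀ v ∈ p, p = {x | χ v x ∈ D} := by
    intro p hp v hv
    ext y
    refine ⟨fun hy => ⟨p, hp, v, hv, y, hy, rfl⟩, ?_⟩
    rintro ⟨r, hr, u, hu, x, hx, hux⟩
    have hy : χ y y = c := (hχ.color_endpoint_eq hux).symm.trans (hsub r hr hx)
    by_cases hvy : v = y
    · exact hvy ▸ hv
    have hne' : u ≠ x := fun h => hvy ((hχ u x v y hux).1.1 h)
    have hmem : χ v y ∈ CP :=
      hux ▸ (hCP u (hsub r hr hu) x (hsub r hr hx) hne').1 ⟨r, hr, hu, hx⟩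
    obtain ⟨s, hs, hvs, hys⟩ := (hCP v (hsub p hp hv) y hy hvy).2 hmem
    exact (huniq v (hsub p hp hv)).unique ⟨hs, hvs⟩ ⟨hp, hv⟩ ▸ hys
  intro p hp q hq
  obtain ⟨v, hv⟩ := hne p hp
  obtain ⟨w, hw⟩ := hne q hq
  have hvc : χ v v = c := hsub p hp hv
  have hwc : χ w w = c := hsub q hq hw
  rw [key p hp v hv, key q hq w hw]
  exact hχ.ncard_color_mem_eq (hvc.trans hwc.symm) D
end

section
/- Let G be a finite simple graph, χ a 2-stable coloring of G, and let W ⊆ V(G) be a union of diagonal color classes of χ (i.e., for all v ∈ W and w ∈ V(G), χ(w,w) = χ(v,v) implies w ∈ W). Then the restriction of χ to W × W is a 2-stable coloring of the induced subgraph G[W]. -/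
/-- In a 2-stable coloring, the color of a pair determines the diagonal color of its second
entry. -/
theorem IsTwoStable.diag_right {V C : Type*} [Finite V] {G : SimpleGraph V} {χ : V → V → C}
    (hχ : IsTwoStable G χ) {u w u' w' : V} (h : χ u w = χ u' w') : χ w w = χ w' w' := by
  have hcard := (hχ u w u' w' h).2.2 (χ u w) (χ w w)
  have hpos : 0 < {z : V | χ u z = χ u w ∧ χ z w = χ w w}.ncard :=
    (Set.ncard_pos (Set.toFinite _)).2 ⟨w, rfl, rfl⟩
  rw [hcard] at hpos
  obtain ⟨z, -, hz⟩ := (Set.ncard_pos (Set.toFinite _)).1 hpos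
  obtain rfl : z = w' := (hχ z w' w w hz).1.2 rfl
  exact hz.symm

theorem stmt13 {V C : Type*} [Fintype V] (G : SimpleGraph V) (χ : V → V → C)
    (hχ : IsTwoStable G χ) (W : Set V)
    (hW : ∀ v ∈ W, ∀ w : V, χ w w = χ v v → w ∈ W) :
    IsTwoStable (G.induce W) (fun x y : W => χ x y) := by
  intro u v u' v' h
  obtain ⟨hdiag, hadj, hcard⟩ := hχ u v u' v' h
  refine ⟨by simpa only [Subtype.ext_iff] using hdiag, hadj, fun a b => ?_⟩
  by_cases ha : ∃ w ∈ W, ∃ x, χ x w = a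
  · obtain ⟨w, hw, x, hx⟩ := ha
    have restrict (y z : V) : {t : W | χ y t = a ∧ χ t z = b}.ncard =
        {t : V | χ y t = a ∧ χ t z = b}.ncard := by
      rw [← Set.ncard_image_of_injective _ Subtype.val_injective]
      congr 1
      ext t
      constructor
      · rintro ⟨t, ht, rfl⟩
        exact ht
      · intro ht
        exact ⟨⟨t, hW w hw t (hχ.diag_right (ht.1.trans hx.symm))⟩, ht, rfl⟩
    exact (restrict u v).trans ((hcard a b).trans (restrict u' v').symm)
  · have empty (y z : V) : {t : W | χ y t = a ∧ χ t z = b} = ∅ :=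
      Set.eq_empty_of_forall_notMem fun t ht => ha ⟨t, t.2, y, ht.1⟩
    exact congrArg Set.ncard ((empty u v).trans (empty u' v').symm)
end
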